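/- arXiv:1607.06648 — 3 statements merged into one kernel-verified Lean document; each statement's English description precedes it below -/
import Mathlib

section
/- Let N ≥ 1 and p > 2. There exists a constant C₁ = C₁(p) > 0 such that for every z, w ∈ ℝ^N one has |z − w| ≤ C₁ |V(z) − V(w)|^{2/p}, where V(z) = |z|^{(p−2)/2} z. -/
open MeasureTheory

lemma half_norm_sub_rpow_le {E : Type*} [SeminormedAddCommGroup E] {a : ℝ}
    (ha : 0 ≤ a) (z w : E) :
    (‖z - w‖ / 2) ^ a ≤ ‖z‖ ^ a + ‖w‖ ^ a := by
  have hsub := norm_sub_le z w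
  have hz := Real.rpow_nonneg (norm_nonneg z) a
  have hw := Real.rpow_nonneg (norm_nonneg w) a
  rcases le_total ‖z‖ ‖w‖ with h | h
  · have := Real.rpow_le_rpow (by positivity) (show ‖z - w‖ / 2 ≤ ‖w‖ by linarith) ha
    linarith
  · have := Real.rpow_le_rpow (by positivity) (show ‖z - w‖ / 2 ≤ ‖z‖ by linarith) ha
    linarith

section

variable {E : Type*} [NormedAddCommGroup E] [InnerProductSpace ℝ E]

/-- The map `z ↦ ‖z‖ ^ a • z` is strongly monotone with weight `(‖z‖ ^ a + ‖w‖ ^ a) / 2`. -/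
lemma mul_norm_sub_sq_le_inner_rpow_smul_sub {a : ℝ} (ha : 0 ≤ a) (z w : E) :
    (‖z‖ ^ a + ‖w‖ ^ a) / 2 * ‖z - w‖ ^ 2 ≤
      inner ℝ (‖z‖ ^ a • z - ‖w‖ ^ a • w) (z - w) := by
  have hmono : 0 ≤ (‖z‖ ^ a - ‖w‖ ^ a) * (‖z‖ ^ 2 - ‖w‖ ^ 2) := by
    rcases le_total ‖z‖ ‖w‖ with h | h
    · exact mul_nonneg_of_nonpos_of_nonpos
        (sub_nonpos.2 (Real.rpow_le_rpow (norm_nonneg _) h ha))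
        (sub_nonpos.2 (pow_le_pow_left₀ (norm_nonneg _) h 2))
    · exact mul_nonneg
        (sub_nonneg.2 (Real.rpow_le_rpow (norm_nonneg _) h ha))
        (sub_nonneg.2 (pow_le_pow_left₀ (norm_nonneg _) h 2))
  rw [norm_sub_sq_real]
  simp only [inner_sub_left, inner_sub_right, real_inner_smul_left,
    real_inner_self_eq_norm_sq, real_inner_comm z w]
  linarith

lemma half_norm_sub_rpow_add_one_le {a : ℝ} (ha : 0 ≤ a) (z w : E) :
    (‖z - w‖ / 2) ^ (a + 1) ≤ ‖‖z‖ ^ a • z - ‖w‖ ^ a • w‖ := by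
  rcases (norm_nonneg (z - w)).eq_or_lt with h | h
  · rw [← h, zero_div, Real.zero_rpow (by positivity)]
    exact norm_nonneg _
  · rw [Real.rpow_add_one (by positivity)]
    refine le_of_mul_le_mul_right ?_ h
    calc (‖z - w‖ / 2) ^ a * (‖z - w‖ / 2) * ‖z - w‖
        = (‖z - w‖ / 2) ^ a / 2 * ‖z - w‖ ^ 2 := by ring
      _ ≤ (‖z‖ ^ a + ‖w‖ ^ a) / 2 * ‖z - w‖ ^ 2 := by
          gcongr
          exact half_norm_sub_rpow_le ha z w
      _ ≤ inner ℝ (‖z‖ ^ a • z - ‖w‖ ^ a • w) (z - w) :=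
          mul_norm_sub_sq_le_inner_rpow_smul_sub ha z w
      _ ≤ _ := real_inner_le_norm _ _

end

/-- For `p > 2` there is `C₁ = C₁(p) > 0` such that for every `N ≥ 1` and all
`z, w ∈ ℝ^N`, `|z - w| ≤ C₁ |V(z) - V(w)|^(2/p)` where `V(z) = |z|^((p-2)/2) z`. -/
theorem statement2 (p : ℝ) (hp : 2 < p) :
    ∃ C : ℝ, 0 < C ∧ ∀ N : ℕ, 1 ≤ N → ∀ z w : EuclideanSpace ℝ (Fin N),
      ‖z - w‖ ≤ C * ‖(‖z‖ ^ ((p - 2) / 2)) • z - (‖w‖ ^ ((p - 2) / 2)) • w‖ ^ (2 / p) := by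
  refine ⟨2, two_pos, fun N _ z w => ?_⟩
  have hp0 : 0 < p := by linarith
  have key := Real.rpow_le_rpow (by positivity)
    (half_norm_sub_rpow_add_one_le (a := (p - 2) / 2) (by linarith) z w)
    (show 0 ≤ 2 / p by positivity)
  rw [← Real.rpow_mul (by positivity), show ((p - 2) / 2 + 1) * (2 / p) = 1 by field_simp; ring,
    Real.rpow_one] at key
  linarith
end

section
/- Let N ≥ 1, p > 2, p' = p/(p−1), ε > 0 and (p−2)/p < s < 1. Let B ⊂ ℝ^N be an open ball, let u ∈ C²(B) and f ∈ C⁰(B) satisfy −div( (ε + |∇u|²)^{(p−2)/2} ∇u ) = f pointwise in B, and set 𝒱_ε(x) = |∇u(x)|^{(p−2)/2} ∇u(x). Then there exists a constant C = C(N,p,s) > 0, independent of ε, u and f, such that for every pair of concentric balls B_r ⋐ B_R ⋐ B with ∫_{B_R}|∇u|^p dx < ∞ and [f]_{W^{s,p'}(B_R)} < ∞, and every j = 1,…,N, one has ∫_{B_r} |∂_j 𝒱_ε|² dx ≤ C (R−r)^{−2} ∫_{B_R} (ε + |∇u|²)^{p/2} dx + C ( R^{s−(p−2)/p} [f]_{W^{s,p'}(B_R)}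 )^{p'}. -/
open MeasureTheory Metric ENNReal

abbrev Euc (N : ℕ) := EuclideanSpace ℝ (Fin N)

/-- The Gagliardo seminorm raised to the power `r`. -/
noncomputable def gagliardoQ {N : ℕ} (γ r : ℝ) (A : Set (Euc N)) (ψ : Euc N → ℝ) : ℝ≥0∞ :=
  ∫⁻ x in A, ∫⁻ y in A, ENNReal.ofReal (|ψ x - ψ y| ^ r / ‖x - y‖ ^ ((N : ℝ) + γ * r))

open Filter Topology in
theorem abs_deriv_le_of_second_difference_le {F : ℝ → ℝ} {F' σ M h₀ : ℝ} (hσ : 0 < σ)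
    (hh : 0 < h₀) (hM : 0 ≤ M) (hF : HasDerivAt F F' 0)
    (hsec : ∀ h, 0 < h → 2 * h ≤ h₀ → |F (2 * h) - 2 * F h + F 0| ≤ M * h ^ (1 + σ)) :
    |F'| ≤ |F h₀ - F 0| / h₀ + M * h₀ ^ σ * (1 - 2 ^ (-σ))⁻¹ := by
  set θ : ℝ := 2 ^ (-σ) with hθ
  have hθ0 : 0 < θ := by positivity
  have hθ1 : θ < 1 := Real.rpow_lt_one_of_one_lt_of_neg (by norm_num) (by linarith)
  set H : ℕ → ℝ := fun k => h₀ * (1 / 2) ^ k with hH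
  have Hpos : ∀ k, 0 < H k := fun k => by positivity
  have Hle : ∀ k, H k ≤ h₀ := fun k => by
    have : (1 / 2 : ℝ) ^ k ≤ 1 := pow_le_one₀ (by norm_num) (by norm_num)
    simp only [hH]; nlinarith
  have Hsucc : ∀ k, H k = 2 * H (k + 1) := fun k => by simp only [hH, pow_succ]; ring
  set D : ℕ → ℝ := fun k => (F (H k) - F 0) / H k with hD
  have Hσ : ∀ k, H k ^ σ = h₀ ^ σ * θ ^ k := fun k => by
    simp only [hH]
    rw [Real.mul_rpow hh.le (by positivity), ← Real.rpow_natCast, ← Real.rpow_mul (by norm_num),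
      ← Real.rpow_natCast θ, hθ, ← Real.rpow_mul (by norm_num), one_div,
      Real.inv_rpow (by norm_num), ← Real.rpow_neg (by norm_num)]
    congr 2; ring
  have step : ∀ k, |D (k + 1)| ≤ |D k| + M * h₀ ^ σ * θ ^ (k + 1) := fun k => by
    have hp := Hpos (k + 1)
    have h1 := hsec (H (k + 1)) hp (by rw [← Hsucc]; exact Hle k)
    have h2 : D (k + 1) = D k - (F (2 * H (k + 1)) - 2 * F (H (k + 1)) + F 0) / (2 * H (k + 1)) := by
      simp only [hD, Hsucc k]; field_simp; ring
    have h3 : |(F (2 * H (k + 1)) - 2 * F (H (k + 1)) + F 0) / (2 * H (k + 1))|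
        ≤ M * H (k + 1) ^ σ := by
      rw [abs_div, abs_of_pos (by positivity : 0 < 2 * H (k + 1)), div_le_iff₀ (by positivity)]
      rw [Real.rpow_add hp, Real.rpow_one] at h1
      have : 0 ≤ M * H (k + 1) ^ σ * H (k + 1) := by positivity
      linarith
    rw [h2, mul_assoc, ← Hσ]
    exact (abs_sub _ _).trans (by linarith)
  have bound : ∀ k, |D k| ≤ |D 0| + M * h₀ ^ σ * ∑ i ∈ Finset.range k, θ ^ (i + 1) := by
    intro k
    induction k with
    | zero => simp
    | succ k ih => rw [Finset.sum_range_succ]; linarith [step k]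
  have bound2 : ∀ k, |D k| ≤ |F h₀ - F 0| / h₀ + M * h₀ ^ σ * (1 - θ)⁻¹ := by
    intro k
    refine (bound k).trans (add_le_add ?_ (mul_le_mul_of_nonneg_left ?_ (by positivity)))
    · simp [hD, hH, abs_div, abs_of_pos hh]
    · rw [← tsum_geometric_of_lt_one hθ0.le hθ1]
      have hs := summable_geometric_of_lt_one hθ0.le hθ1
      refine le_trans ?_ (hs.sum_le_tsum (Finset.range k) (fun i _ => by positivity))
      exact Finset.sum_le_sum fun i _ => pow_le_pow_of_le_one hθ0.le hθ1.le (Nat.le_succ i)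
  have lim : Tendsto D atTop (𝓝 F') := by
    have h0 : Tendsto H atTop (𝓝[≠] 0) := by
      refine tendsto_nhdsWithin_iff.2 ⟨?_, Eventually.of_forall fun k => (Hpos k).ne'⟩
      simpa [hH] using (tendsto_pow_atTop_nhds_zero_of_lt_one (by norm_num : (0 : ℝ) ≤ 1 / 2)
        (by norm_num)).const_mul h₀
    have := (hasDerivAt_iff_tendsto_slope.1 hF).comp h0
    refine this.congr fun k => ?_
    simp [slope_def_field, hD]
  exact le_of_tendsto lim.abs (Eventually.of_forall bound2)

theorem hasDerivAt_abs_rpow_mul_self {m : ℝ} (hm : 0 < m) (t : ℝ) :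
    HasDerivAt (fun t : ℝ => |t| ^ m * t) ((m + 1) * |t| ^ m) t := by
  rcases eq_or_ne t 0 with rfl | ht
  · rw [abs_zero, Real.zero_rpow hm.ne', mul_zero, hasDerivAt_iff_tendsto_slope]
    have h : Filter.Tendsto (fun t : ℝ => |t| ^ m) (nhds 0) (nhds 0) := by
      have := (continuous_abs.rpow_const (fun _ => Or.inr hm.le) : Continuous fun t : ℝ => |t| ^ m)
      simpa [Real.zero_rpow hm.ne'] using this.tendsto 0
    refine (h.mono_left nhdsWithin_le_nhds).congr' ?_
    filter_upwards [self_mem_nhdsWithin] with y hy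
    have hy' : y ≠ 0 := hy
    simp [slope_def_field, hy']
  · have h1 := ((hasDerivAt_abs ht).rpow_const (p := m) (Or.inl (abs_ne_zero.2 ht))).mul
      (hasDerivAt_id t)
    refine h1.congr_deriv ?_
    have h2 : (SignType.sign t : ℝ) * t = |t| := by simp
    simp only [id, mul_one]
    rw [show (SignType.sign t : ℝ) * m * |t| ^ (m - 1) * t
      = m * |t| ^ (m - 1) * ((SignType.sign t : ℝ) * t) by ring, h2, mul_assoc,
      ← Real.rpow_add_one (abs_ne_zero.2 ht)]
    ring_nf

theorem abs_sub_rpow_le {m : ℝ} (hm : 0 < m) (a b : ℝ) :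
    |a - b| ^ (m + 1) ≤ 2 ^ (m + 1) * |(|a| ^ m * a) - |b| ^ m * b| := by
  rcases eq_or_ne a b with rfl | hab
  · simp [Real.zero_rpow (by linarith : m + 1 ≠ 0)]
  have hd : 0 < |a - b| := abs_pos.2 (sub_ne_zero.2 hab)
  have ha := Real.rpow_nonneg (abs_nonneg a) m
  have hb := Real.rpow_nonneg (abs_nonneg b) m
  have key : (|a| ^ m + |b| ^ m) * |a - b| ^ 2 ≤
      2 * (|(|a| ^ m * a) - |b| ^ m * b| * |a - b|) := by
    rw [← abs_mul, sq_abs]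
    refine le_trans ?_ (mul_le_mul_of_nonneg_left (le_abs_self _) zero_le_two)
    have h1 : 0 ≤ (|a| ^ m - |b| ^ m) * (|a| ^ 2 - |b| ^ 2) := by
      rcases le_total |a| |b| with h | h
      · exact mul_nonneg_of_nonpos_of_nonpos
          (sub_nonpos.2 (Real.rpow_le_rpow (abs_nonneg _) h hm.le))
          (sub_nonpos.2 (pow_le_pow_left₀ (abs_nonneg _) h 2))
      · exact mul_nonneg (sub_nonneg.2 (Real.rpow_le_rpow (abs_nonneg _) h hm.le))
          (sub_nonneg.2 (pow_le_pow_left₀ (abs_nonneg _) h 2))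
    rw [sq_abs, sq_abs] at h1
    linarith
  have hmax : |a - b| ^ m ≤ 2 ^ m * (|a| ^ m + |b| ^ m) := by
    have : |a - b| ≤ 2 * max |a| |b| := by
      linarith [abs_sub a b, le_max_left |a| |b|, le_max_right |a| |b|]
    refine (Real.rpow_le_rpow hd.le this hm.le).trans ?_
    rw [Real.mul_rpow zero_le_two (le_max_of_le_left (abs_nonneg a))]
    refine mul_le_mul_of_nonneg_left ?_ (by positivity)
    rcases max_choice |a| |b| with h | h <;> rw [h] <;> linarith
  rw [Real.rpow_add_one hd.ne', Real.rpow_add_one two_ne_zero]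
  have h2 : (|a| ^ m + |b| ^ m) * |a - b| ≤ 2 * |(|a| ^ m * a) - |b| ^ m * b| := by
    nlinarith
  have := mul_le_mul_of_nonneg_right hmax hd.le
  have h4 := mul_le_mul_of_nonneg_left h2 (by positivity : (0:ℝ) ≤ 2 ^ m)
  linarith

theorem exists_contDiff_cutoff (N : ℕ) : ∃ K : ℝ, 0 < K ∧ ∀ (x₀ : Euc N) (r t : ℝ), 0 < r → r < t →
    ∃ ζ : Euc N → ℝ, ContDiff ℝ 1 ζ ∧ (∀ x, 0 ≤ ζ x) ∧ (∀ x, ζ x ≤ 1) ∧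
      (∀ x ∈ ball x₀ r, ζ x = 1) ∧ (∀ x, x ∉ ball x₀ t → ζ x = 0) ∧
      ∀ x, ‖fderiv ℝ ζ x‖ ≤ K / (t - r) := by
  have hs : ContDiff ℝ 1 Real.smoothTransition := Real.smoothTransition.contDiff
  have hsupp : HasCompactSupport (deriv Real.smoothTransition) := by
    refine HasCompactSupport.intro (isCompact_Icc (a := (0 : ℝ)) (b := 1)) fun x hx => ?_
    rcases not_and_or.1 hx with h | h
    · have : Real.smoothTransition =ᶠ[nhds x] fun _ => 0 := by
        filter_upwards [Iio_mem_nhds (not_le.1 h)] with y hy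
        exact Real.smoothTransition.zero_of_nonpos (le_of_lt hy)
      simp [this.deriv_eq]
    · have : Real.smoothTransition =ᶠ[nhds x] fun _ => 1 := by
        filter_upwards [Ioi_mem_nhds (not_le.1 h)] with y hy
        exact Real.smoothTransition.one_of_one_le (le_of_lt hy)
      simp [this.deriv_eq]
  obtain ⟨K, hK⟩ := hsupp.exists_bound_of_continuous (hs.continuous_deriv le_rfl)
  have hKlip : LipschitzWith (Real.toNNReal (max K 1)) Real.smoothTransition := by
    refine lipschitzWith_of_nnnorm_deriv_le (hs.differentiable one_ne_zero) fun x => ?_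
    rw [← NNReal.coe_le_coe, coe_nnnorm, Real.coe_toNNReal _ (by positivity)]
    exact (hK x).trans (le_max_left _ _)
  refine ⟨max K 1, by positivity, fun x₀ r t hr hrt => ?_⟩
  have hd : 0 < t - r := sub_pos.2 hrt
  refine ⟨fun x => Real.smoothTransition ((t - ‖x - x₀‖) / (t - r)), ?_,
    fun x => Real.smoothTransition.nonneg _, fun x => Real.smoothTransition.le_one _,
    fun x hx => ?_, fun x hx => ?_, fun x => ?_⟩
  · refine contDiff_iff_contDiffAt.2 fun x => ?_
    rcases eq_or_ne x x₀ with rfl | hx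
    · have : (fun y => Real.smoothTransition ((t - ‖y - x‖) / (t - r))) =ᶠ[nhds x] fun _ => 1 := by
        filter_upwards [ball_mem_nhds x hr] with y hy
        rw [mem_ball_iff_norm] at hy
        exact Real.smoothTransition.one_of_one_le ((one_le_div hd).2 (by linarith))
      exact contDiffAt_const.congr_of_eventuallyEq this
    · exact hs.contDiffAt.comp x ((contDiffAt_const.sub
        ((contDiffAt_id.sub contDiffAt_const).norm ℝ (sub_ne_zero.2 hx))).div_const _)
  · rw [mem_ball_iff_norm] at hx
    exact Real.smoothTransition.one_of_one_le ((one_le_div hd).2 (by linarith))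
  · rw [mem_ball_iff_norm, not_lt] at hx
    exact Real.smoothTransition.zero_of_nonpos (div_nonpos_of_nonpos_of_nonneg (by linarith) hd.le)
  · have hl : LipschitzWith (Real.toNNReal (t - r)⁻¹) fun x : Euc N => (t - ‖x - x₀‖) / (t - r) := by
      refine LipschitzWith.of_dist_le_mul fun a b => ?_
      rw [Real.coe_toNNReal _ (by positivity), Real.dist_eq, ← sub_div, abs_div, abs_of_pos hd,
        div_eq_inv_mul, dist_eq_norm]
      refine mul_le_mul_of_nonneg_left ?_ (by positivity)
      rw [show t - ‖a - x₀‖ - (t - ‖b - x₀‖) = ‖b - x₀‖ - ‖a - x₀‖ by ring, abs_sub_comm]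
      exact (abs_norm_sub_norm_le _ _).trans (by simp)
    have := norm_fderiv_le_of_lipschitz ℝ (hKlip.comp hl) (x₀ := x)
    rw [NNReal.coe_mul, Real.coe_toNNReal _ (by positivity), Real.coe_toNNReal _ (by positivity),
      ← div_eq_mul_inv] at this
    exact this

theorem hasFDerivAt_rpow_smul {E F : Type*} [NormedAddCommGroup E] [NormedSpace ℝ E]
    [NormedAddCommGroup F] [InnerProductSpace ℝ F] {v : E → F} {x : E} {δ : ℝ} (q : ℝ)
    (hv : DifferentiableAt ℝ v x) (hpos : 0 < δ + ‖v x‖ ^ 2) :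
    HasFDerivAt (fun y => (δ + ‖v y‖ ^ 2) ^ q • v y)
      ((δ + ‖v x‖ ^ 2) ^ q • fderiv ℝ v x +
        ((q * (δ + ‖v x‖ ^ 2) ^ (q - 1)) • (2 • (innerSL ℝ (v x)).comp (fderiv ℝ v x))).smulRight
          (v x)) x :=
  (((hv.hasFDerivAt.norm_sq).const_add δ).rpow_const (p := q) (Or.inl hpos.ne')).smul hv.hasFDerivAt

theorem norm_fderiv_rpow_smul_apply_le {E F : Type*} [NormedAddCommGroup E] [NormedSpace ℝ E]
    [NormedAddCommGroup F] [InnerProductSpace ℝ F] {v : E → F} {x : E} {δ q : ℝ} (hq : 0 ≤ q)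
    (hδ : 0 ≤ δ) (hv : DifferentiableAt ℝ v x) (hpos : 0 < δ + ‖v x‖ ^ 2) (e : E) :
    ‖fderiv ℝ (fun y => (δ + ‖v y‖ ^ 2) ^ q • v y) x e‖ ≤
      (1 + 2 * q) * (δ + ‖v x‖ ^ 2) ^ q * ‖fderiv ℝ v x e‖ := by
  rw [(hasFDerivAt_rpow_smul q hv hpos).fderiv]
  set w := δ + ‖v x‖ ^ 2 with hw
  set ξ := fderiv ℝ v x e with hξ
  have h1 : ‖v x‖ ^ 2 ≤ w := by linarith
  simp only [add_apply, smul_apply,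
    ContinuousLinearMap.smulRight_apply, ContinuousLinearMap.comp_apply, innerSL_apply_apply, ← hξ]
  refine (norm_add_le _ _).trans ?_
  rw [norm_smul, norm_smul, Real.norm_of_nonneg (by positivity)]
  have h2 : ‖(q * w ^ (q - 1)) • 2 • inner ℝ (v x) ξ‖ ≤ 2 * q * w ^ (q - 1) * (‖v x‖ * ‖ξ‖) := by
    rw [norm_smul, Real.norm_of_nonneg (by positivity), nsmul_eq_mul, norm_mul]
    have := norm_inner_le_norm (𝕜 := ℝ) (v x) ξ
    have h3 : 0 ≤ q * w ^ (q - 1) := by positivity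
    have h4 := mul_le_mul_of_nonneg_left this h3
    simp only [Nat.cast_ofNat, Real.norm_ofNat]
    linarith
  have h5 := mul_le_mul_of_nonneg_right h2 (norm_nonneg (v x))
  have h6 : w ^ q = w ^ (q - 1) * w := by rw [← Real.rpow_add_one hpos.ne']; ring_nf
  have h7 : 2 * q * w ^ (q - 1) * ‖ξ‖ * ‖v x‖ ^ 2 ≤ 2 * q * w ^ (q - 1) * ‖ξ‖ * w :=
    mul_le_mul_of_nonneg_left h1 (by positivity)
  rw [h6]
  rw [h6] at *
  nlinarith

theorem le_inner_fderiv_rpow_smul_apply {E F : Type*} [NormedAddCommGroup E] [NormedSpace ℝ E]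
    [NormedAddCommGroup F] [InnerProductSpace ℝ F] {v : E → F} {x : E} {δ q : ℝ} (hq : 0 ≤ q)
    (hv : DifferentiableAt ℝ v x) (hpos : 0 < δ + ‖v x‖ ^ 2) (e : E) :
    (δ + ‖v x‖ ^ 2) ^ q * ‖fderiv ℝ v x e‖ ^ 2 ≤
      inner ℝ (fderiv ℝ (fun y => (δ + ‖v y‖ ^ 2) ^ q • v y) x e) (fderiv ℝ v x e) := by
  rw [(hasFDerivAt_rpow_smul q hv hpos).fderiv]
  simp only [add_apply, smul_apply,
    ContinuousLinearMap.smulRight_apply, ContinuousLinearMap.comp_apply, innerSL_apply_apply,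
    inner_add_left, real_inner_smul_left, real_inner_self_eq_norm_sq, nsmul_eq_mul, smul_eq_mul]
  have : 0 ≤ q * (δ + ‖v x‖ ^ 2) ^ (q - 1) := by positivity
  have := mul_nonneg this (mul_self_nonneg (inner ℝ (v x) (fderiv ℝ v x e)))
  push_cast
  nlinarith

theorem norm_fderiv_norm_rpow_smul_apply_le {E F : Type*} [NormedAddCommGroup E] [NormedSpace ℝ E]
    [NormedAddCommGroup F] [InnerProductSpace ℝ F] {v : E → F} {x : E} {m : ℝ} (hm : 0 < m)
    (hv : DifferentiableAt ℝ v x) (e : E) :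
    ‖fderiv ℝ (fun y => ‖v y‖ ^ m • v y) x e‖ ≤ (1 + m) * ‖v x‖ ^ m * ‖fderiv ℝ v x e‖ := by
  rcases eq_or_ne (v x) 0 with h0 | h0
  · have h : HasFDerivAt (fun y => ‖v y‖ ^ m • v y) (0 : E →L[ℝ] F) x := by
      rw [hasFDerivAt_iff_isLittleO]
      simp only [h0, smul_zero, sub_zero, zero_apply]
      have h1 : (fun y => v y) =O[nhds x] fun y => y - x := by
        simpa [h0] using hv.hasFDerivAt.isBigO_sub
      have h2 : (fun y => ‖v y‖ ^ m) =o[nhds x] fun _ => (1 : ℝ) := by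
        rw [Asymptotics.isLittleO_one_iff]
        have := (hv.continuousAt.norm.rpow_const (p := m) (Or.inr hm.le)).tendsto
        simpa [h0, Real.zero_rpow hm.ne'] using this
      simpa using h2.smul_isBigO h1
    simp [h.fderiv, h0, Real.zero_rpow hm.ne']
  · have h := norm_fderiv_rpow_smul_apply_le (v := v) (x := x) (δ := 0) (q := m / 2) (by positivity)
      le_rfl hv (by positivity) e
    have h2 : ∀ y, ((0 : ℝ) + ‖v y‖ ^ 2) ^ (m / 2) = ‖v y‖ ^ m := fun y => by
      rw [zero_add, ← Real.rpow_natCast, ← Real.rpow_mul (norm_nonneg _)]; congr 1; push_cast; ring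
    simp only [h2] at h
    convert h using 3
    ring

theorem volume_ball_half_mul_lintegral_diff_le {N : ℕ} {s q : ℝ} (hs : 0 < s) (hq : 1 ≤ q)
    {f : Euc N → ℝ} (hf : Continuous f) (x₀ : Euc N) (R : ℝ) (h : Euc N) :
    volume (ball ((1 / 2 : ℝ) • h) (‖h‖ / 2)) *
        ∫⁻ x in ball x₀ (R - ‖h‖), ‖f (x + h) - f x‖ₑ ^ q ≤
      2 ^ q * (ENNReal.ofReal (‖h‖ ^ (N + s * q)) * gagliardoQ s q (ball x₀ R) f) := by
  have hq0 : 0 < q := by linarith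
  set A := ball x₀ R with hA
  have hAm : MeasurableSet A := measurableSet_ball
  set S := ball ((1 / 2 : ℝ) • h) (‖h‖ / 2) with hS
  set α : ℝ := N + s * q with hα
  have hα0 : 0 < α := by positivity
  set k : Euc N → Euc N → ℝ≥0∞ := fun x y =>
    A.indicator (fun x => A.indicator
      (fun y => ENNReal.ofReal (|f x - f y| ^ q / ‖x - y‖ ^ α)) y) x with hk
  have hkint : ∫⁻ x, ∫⁻ y, k x y = gagliardoQ s q A f := by
    rw [gagliardoQ, ← lintegral_indicator hAm]
    refine lintegral_congr fun x => ?_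
    by_cases hx : x ∈ A
    · simp only [hk, Set.indicator_of_mem hx]
      rw [lintegral_indicator hAm]
    · simp [hk, Set.indicator_of_notMem hx]
  have hkey : ∀ x y, x ∈ A → y ∈ A → ‖x - y‖ ≤ ‖h‖ →
      ‖f x - f y‖ₑ ^ q ≤ ENNReal.ofReal (‖h‖ ^ α) * k x y := by
    intro x y hx hy hxy
    rcases eq_or_ne x y with rfl | hne
    · simp [ENNReal.zero_rpow_of_pos hq0]
    have hpos : 0 < ‖x - y‖ := norm_pos_iff.2 (sub_ne_zero.2 hne)
    simp only [hk, Set.indicator_of_mem hx, Set.indicator_of_mem hy]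
    rw [Real.enorm_eq_ofReal_abs, ENNReal.ofReal_rpow_of_nonneg (abs_nonneg _) hq0.le,
      ← ENNReal.ofReal_mul (by positivity)]
    refine ENNReal.ofReal_le_ofReal ?_
    rw [mul_div_assoc', le_div_iff₀ (by positivity), mul_comm]
    exact mul_le_mul_of_nonneg_right (Real.rpow_le_rpow hpos.le hxy hα0.le) (by positivity)
  have hmemS : ∀ w ∈ S, ‖w‖ ≤ ‖h‖ ∧ ‖h - w‖ ≤ ‖h‖ := by
    intro w hw
    rw [hS, mem_ball_iff_norm] at hw
    have h2 : ‖(1 / 2 : ℝ) • h‖ = ‖h‖ / 2 := by rw [norm_smul]; norm_num; ring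
    constructor
    · have := norm_add_le (w - (1 / 2 : ℝ) • h) ((1 / 2 : ℝ) • h)
      rw [sub_add_cancel] at this
      linarith
    · have := norm_sub_le ((1 / 2 : ℝ) • h) (w - (1 / 2 : ℝ) • h)
      rw [show (1 / 2 : ℝ) • h - (w - (1 / 2 : ℝ) • h) = h - w by
        rw [sub_sub_eq_add_sub, ← add_smul]; norm_num] at this
      linarith
  have hpt : ∀ x ∈ ball x₀ (R - ‖h‖), ∀ w ∈ S, ‖f (x + h) - f x‖ₑ ^ q ≤
      2 ^ (q - 1) * (ENNReal.ofReal (‖h‖ ^ α) * k (x + h) (x + w) +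
        ENNReal.ofReal (‖h‖ ^ α) * k x (x + w)) := by
    intro x hx w hw
    rw [mem_ball_iff_norm] at hx
    have hxA : x ∈ A := by rw [hA, mem_ball_iff_norm]; linarith [norm_nonneg h]
    have hin : ∀ z : Euc N, ‖z‖ ≤ ‖h‖ → x + z ∈ A := fun z hz => by
      rw [hA, mem_ball_iff_norm, add_sub_right_comm]
      linarith [norm_add_le (x - x₀) z]
    obtain ⟨hw1, hw2⟩ := hmemS w hw
    calc ‖f (x + h) - f x‖ₑ ^ q
        ≤ (‖f (x + h) - f (x + w)‖ₑ + ‖f x - f (x + w)‖ₑ) ^ q := by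
          refine ENNReal.rpow_le_rpow ?_ hq0.le
          rw [← edist_eq_enorm_sub, ← edist_eq_enorm_sub, ← edist_eq_enorm_sub,
            edist_comm (f x) (f (x + w))]
          exact edist_triangle _ _ _
      _ ≤ 2 ^ (q - 1) * (‖f (x + h) - f (x + w)‖ₑ ^ q + ‖f x - f (x + w)‖ₑ ^ q) :=
          ENNReal.rpow_add_le_mul_rpow_add_rpow _ _ hq
      _ ≤ _ := by
          gcongr
          · exact hkey _ _ (hin h le_rfl) (hin w hw1) (by simpa using hw2)
          · exact hkey _ _ hxA (hin w hw1) (by simpa using hw1)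
  have hkm : Measurable (Function.uncurry k) := by
    have h1 : Measurable fun z : Euc N × Euc N =>
        ENNReal.ofReal (|f z.1 - f z.2| ^ q / ‖z.1 - z.2‖ ^ α) := by fun_prop
    have h2 : Function.uncurry k = (A ×ˢ A).indicator fun z : Euc N × Euc N =>
        ENNReal.ofReal (|f z.1 - f z.2| ^ q / ‖z.1 - z.2‖ ^ α) := by
      ext ⟨x, y⟩
      by_cases hx : x ∈ A <;> by_cases hy : y ∈ A <;> simp [hk, hx, hy]
    rw [h2]
    exact h1.indicator (hAm.prod hAm)
  have hkm1 : ∀ x, Measurable (k x) := fun x => hkm.of_uncurry_left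
  calc volume S * ∫⁻ x in ball x₀ (R - ‖h‖), ‖f (x + h) - f x‖ₑ ^ q
      = ∫⁻ x in ball x₀ (R - ‖h‖), ∫⁻ _w in S, ‖f (x + h) - f x‖ₑ ^ q := by
        have hSfin : volume S ≠ ⊤ := measure_ball_lt_top.ne
        rw [mul_comm, ← lintegral_mul_const' _ _ hSfin]
        simp only [setLIntegral_const]
    _ ≤ ∫⁻ x in ball x₀ (R - ‖h‖), ∫⁻ w in S, 2 ^ (q - 1) *
          (ENNReal.ofReal (‖h‖ ^ α) * k (x + h) (x + w) +
            ENNReal.ofReal (‖h‖ ^ α) * k x (x + w)) :=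
        setLIntegral_mono' measurableSet_ball fun x hx =>
          setLIntegral_mono' measurableSet_ball fun w hw => hpt x hx w hw
    _ ≤ ∫⁻ x, ∫⁻ w, 2 ^ (q - 1) * (ENNReal.ofReal (‖h‖ ^ α) * k (x + h) (x + w) +
            ENNReal.ofReal (‖h‖ ^ α) * k x (x + w)) :=
        (setLIntegral_le_lintegral _ _).trans
          (lintegral_mono fun x => setLIntegral_le_lintegral _ _)
    _ = ∫⁻ x, 2 ^ (q - 1) * (ENNReal.ofReal (‖h‖ ^ α) * (∫⁻ y, k (x + h) y) +
            ENNReal.ofReal (‖h‖ ^ α) * ∫⁻ y, k x y) := by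
        refine lintegral_congr fun x => ?_
        rw [lintegral_const_mul' _ _ (by simp), lintegral_add_left (by fun_prop),
          lintegral_const_mul' _ _ (by simp), lintegral_const_mul' _ _ (by simp),
          lintegral_add_left_eq_self (k (x + h)), lintegral_add_left_eq_self (k x)]
    _ = 2 ^ (q - 1) * (ENNReal.ofReal (‖h‖ ^ α) * gagliardoQ s q A f +
          ENNReal.ofReal (‖h‖ ^ α) * gagliardoQ s q A f) := by
        have hkm2 : Measurable fun x => ∫⁻ y, k x y := hkm.lintegral_prod_right'
        rw [lintegral_const_mul' _ _ (by simp), lintegral_add_left (by fun_prop),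
          lintegral_const_mul' _ _ (by simp), lintegral_const_mul' _ _ (by simp),
          lintegral_add_right_eq_self (fun x => ∫⁻ y, k x y), hkint]
    _ = _ := by
        have h2 : (2 : ℝ≥0∞) ^ (q - 1) * 2 = 2 ^ q := by
          conv_lhs => rw [← ENNReal.rpow_one 2, ← ENNReal.rpow_mul, one_mul]
          rw [← ENNReal.rpow_add _ _ two_ne_zero (by simp), sub_add_cancel]
        rw [← two_mul, ← mul_assoc, h2]

/-- Functions of finite Gagliardo seminorm satisfy a Nikolskii estimate. -/
theorem exists_lintegral_diff_le_gagliardoQ (N : ℕ) (hN : 1 ≤ N) {s q : ℝ} (hs : 0 < s)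
    (hq : 1 ≤ q) : ∃ C : ℝ, 0 < C ∧ ∀ (f : Euc N → ℝ), Continuous f → ∀ (x₀ : Euc N) (R : ℝ)
      (h : Euc N), h ≠ 0 →
      ∫⁻ x in ball x₀ (R - ‖h‖), ‖f (x + h) - f x‖ₑ ^ q ≤
        ENNReal.ofReal (C * ‖h‖ ^ (s * q)) * gagliardoQ s q (ball x₀ R) f := by
  have : Nonempty (Fin N) := ⟨⟨0, hN⟩⟩
  have : Nontrivial (Euc N) := inferInstance
  set ω : ℝ := (volume (ball (0 : Euc N) 1)).toReal with hω
  have hω0 : 0 < ω := ENNReal.toReal_pos (measure_ball_pos _ _ one_pos).ne' measure_ball_lt_top.ne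
  refine ⟨2 ^ q * 2 ^ (N : ℝ) / ω, by positivity, fun f hf x₀ R h hh => ?_⟩
  have hh0 : 0 < ‖h‖ := norm_pos_iff.2 hh
  have h1 := volume_ball_half_mul_lintegral_diff_le hs hq hf x₀ R h
  have hv : volume (ball ((1 / 2 : ℝ) • h) (‖h‖ / 2)) = ENNReal.ofReal ((‖h‖ / 2) ^ (N : ℝ) * ω) := by
    rw [Measure.addHaar_ball _ _ (by positivity), ENNReal.ofReal_mul (by positivity), hω,
      ENNReal.ofReal_toReal measure_ball_lt_top.ne, finrank_euclideanSpace, Fintype.card_fin,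
      Real.rpow_natCast]
  set V : ℝ := (‖h‖ / 2) ^ (N : ℝ) * ω with hV
  have hV0 : 0 < V := by positivity
  rw [hv] at h1
  set I := ∫⁻ x in ball x₀ (R - ‖h‖), ‖f (x + h) - f x‖ₑ ^ q
  have h2 : I = ENNReal.ofReal V⁻¹ * (ENNReal.ofReal V * I) := by
    rw [← mul_assoc, ← ENNReal.ofReal_mul (by positivity), inv_mul_cancel₀ hV0.ne',
      ENNReal.ofReal_one, one_mul]
  rw [h2]
  refine (mul_le_mul_right h1 _).trans (le_of_eq ?_)
  rw [show (2 : ℝ≥0∞) ^ q = ENNReal.ofReal (2 ^ q) by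
    rw [← ENNReal.ofReal_rpow_of_pos two_pos]; simp, ← mul_assoc, ← mul_assoc,
    ← ENNReal.ofReal_mul (by positivity), ← ENNReal.ofReal_mul (by positivity)]
  congr 2
  rw [hV, Real.rpow_add hh0, Real.div_rpow hh0.le two_pos.le]
  have : 0 < ‖h‖ ^ (N : ℝ) := by positivity
  field_simp

theorem sq_lintegral_le {α : Type*} [MeasurableSpace α] (μ : Measure α) {φ : α → ℝ≥0∞}
    (hφ : AEMeasurable φ μ) : (∫⁻ t, φ t ∂μ) ^ 2 ≤ μ Set.univ * ∫⁻ t, φ t ^ 2 ∂μ := by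
  have h := ENNReal.lintegral_mul_le_Lp_mul_Lq μ Real.HolderConjugate.two_two
    (f := fun _ => 1) aemeasurable_const hφ
  simp only [Pi.mul_apply, one_mul, lintegral_const, ENNReal.rpow_two, one_pow] at h
  calc (∫⁻ t, φ t ∂μ) ^ 2 ≤ (μ Set.univ ^ (1 / 2 : ℝ) * (∫⁻ t, φ t ^ 2 ∂μ) ^ (1 / 2 : ℝ)) ^ 2 := by
        gcongr
    _ = _ := by
        rw [mul_pow, ← ENNReal.rpow_natCast, ← ENNReal.rpow_natCast, ← ENNReal.rpow_mul,
          ← ENNReal.rpow_mul]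
        norm_num

theorem lintegral_diff_rpow_le {E : Type*} [NormedAddCommGroup E] [NormedSpace ℝ E]
    [FiniteDimensional ℝ E] [MeasurableSpace E] [BorelSpace E] (μ : Measure E) [μ.IsAddHaarMeasure]
    {m : ℝ} (hm : 0 < m) {g : E → ℝ} (hg : ContDiff ℝ 1 g) (e : E) {h : ℝ} (hh : 0 ≤ h) :
    ∫⁻ x, ‖g (x + h • e) - g x‖ₑ ^ (2 * (m + 1)) ∂μ ≤
      ENNReal.ofReal ((2 ^ (m + 1) * (m + 1)) ^ 2 * h ^ 2) *
        ∫⁻ x, ‖|g x| ^ m * fderiv ℝ g x e‖ₑ ^ 2 ∂μ := by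
  set k : E → ℝ := fun x => |g x| ^ m * fderiv ℝ g x e with hk
  have hkc : Continuous k := (hg.continuous.abs.rpow_const fun _ => Or.inr hm.le).mul
    ((hg.continuous_fderiv one_ne_zero).clm_apply continuous_const)
  set c : ℝ := 2 ^ (m + 1) * (m + 1) with hc
  have hc0 : 0 < c := by positivity
  have hpt : ∀ x, ‖g (x + h • e) - g x‖ₑ ^ (2 * (m + 1)) ≤
      ENNReal.ofReal (c ^ 2 * h) * ∫⁻ t in Set.Ioc 0 h, ‖k (x + t • e)‖ₑ ^ 2 := by
    intro x
    have hline : ∀ t : ℝ, HasDerivAt (fun t : ℝ => x + t • e) e t := fun t => by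
      simpa using ((hasDerivAt_id t).smul_const e).const_add x
    have hder : ∀ t ∈ Set.uIcc 0 h,
        HasDerivAt (fun t : ℝ => |g (x + t • e)| ^ m * g (x + t • e)) ((m + 1) * k (x + t • e)) t := by
      intro t _
      have h1 := ((hg.differentiable one_ne_zero (x + t • e)).hasFDerivAt).comp_hasDerivAt t (hline t)
      have h2 := (hasDerivAt_abs_rpow_mul_self hm (g (x + t • e))).comp t h1
      simp only [hk, ← mul_assoc]
      exact h2
    have hline_cont : Continuous fun t : ℝ => x + t • e := by fun_prop
    have hcont : Continuous fun t : ℝ => (m + 1) * k (x + t • e) :=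
      continuous_const.mul (hkc.comp hline_cont)
    have hftc := intervalIntegral.integral_eq_sub_of_hasDerivAt hder
      (hcont.intervalIntegrable 0 h)
    rw [intervalIntegral.integral_of_le hh] at hftc
    have h3 : ‖g (x + h • e) - g x‖ₑ ^ (m + 1) ≤
        ENNReal.ofReal c * ∫⁻ t in Set.Ioc 0 h, ‖k (x + t • e)‖ₑ := by
      have h4 := abs_sub_rpow_le hm (g (x + h • e)) (g x)
      simp only [zero_smul, add_zero] at hftc
      rw [← hftc, integral_const_mul, abs_mul, abs_of_pos (by linarith : 0 < m + 1),
        ← mul_assoc] at h4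
      rw [Real.enorm_eq_ofReal_abs, ENNReal.ofReal_rpow_of_nonneg (abs_nonneg _) (by linarith)]
      refine (ENNReal.ofReal_le_ofReal h4).trans ?_
      rw [ENNReal.ofReal_mul hc0.le, ← Real.enorm_eq_ofReal_abs]
      exact mul_le_mul_right (enorm_integral_le_lintegral_enorm _) _
    rw [mul_comm 2, ENNReal.rpow_mul, ENNReal.rpow_two]
    refine (pow_le_pow_left' h3 2).trans ?_
    rw [mul_pow, ← ENNReal.ofReal_pow hc0.le, ENNReal.ofReal_mul (by positivity), mul_assoc]
    refine mul_le_mul_right ((sq_lintegral_le _ ?_).trans (le_of_eq ?_)) _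
    · exact ((hkc.comp hline_cont).enorm.measurable).aemeasurable
    · simp
  have hmeas : Measurable (Function.uncurry fun (x : E) (t : ℝ) => ‖k (x + t • e)‖ₑ ^ 2) := by
    have : Continuous fun z : E × ℝ => k (z.1 + z.2 • e) := hkc.comp (by fun_prop)
    exact (this.enorm.measurable).pow_const 2
  calc ∫⁻ x, ‖g (x + h • e) - g x‖ₑ ^ (2 * (m + 1)) ∂μ
      ≤ ∫⁻ x, ENNReal.ofReal (c ^ 2 * h) * (∫⁻ t in Set.Ioc 0 h, ‖k (x + t • e)‖ₑ ^ 2) ∂μ :=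
        lintegral_mono hpt
    _ = ENNReal.ofReal (c ^ 2 * h) * ∫⁻ _t in Set.Ioc 0 h, (∫⁻ x, ‖k x‖ₑ ^ 2 ∂μ) := by
        rw [lintegral_const_mul' _ _ ENNReal.ofReal_ne_top, lintegral_lintegral_swap hmeas.aemeasurable]
        congr 1
        refine lintegral_congr fun t => ?_
        rw [lintegral_add_right_eq_self (fun x => ‖k x‖ₑ ^ 2)]
    _ = _ := by
        rw [setLIntegral_const, Real.volume_Ioc, sub_zero, mul_comm (∫⁻ x, ‖k x‖ₑ ^ 2 ∂μ), ← mul_assoc,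
          ← ENNReal.ofReal_mul (by positivity)]
        congr 2
        ring

theorem enorm_integral_mul_le {α : Type*} [MeasurableSpace α] (μ : Measure α) {p q : ℝ}
    (hqp : q.HolderConjugate p) {φ ψ : α → ℝ} (hφ : AEMeasurable φ μ) (hψ : AEMeasurable ψ μ)
    {S : Set α} (hS : ∀ x, x ∉ S → ψ x = 0) :
    ‖∫ x, φ x * ψ x ∂μ‖ₑ ≤
      (∫⁻ x in S, ‖φ x‖ₑ ^ q ∂μ) ^ (1 / q) * (∫⁻ x, ‖ψ x‖ₑ ^ p ∂μ) ^ (1 / p) := by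
  rw [← setIntegral_eq_integral_of_forall_compl_eq_zero (s := S) (fun x hx => by simp [hS x hx])]
  refine (enorm_integral_le_lintegral_enorm _).trans ?_
  simp only [enorm_mul]
  refine (ENNReal.lintegral_mul_le_Lp_mul_Lq (μ.restrict S) hqp hφ.enorm.restrict
    hψ.enorm.restrict).trans ?_
  gcongr
  · exact one_div_nonneg.2 hqp.symm.nonneg
  · exact Measure.restrict_le_self

theorem hasDerivAt_integral_neg_div_mul {N : ℕ} {a : Euc N → Euc N} (ha : ContDiff ℝ 1 a)
    (hac : HasCompactSupport a) {g : Euc N → ℝ} (hg : ContDiff ℝ 1 g) (hgc : HasCompactSupport g)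
    (e : Euc N) :
    HasDerivAt (fun t : ℝ => ∫ x, (-∑ i, fderiv ℝ a (x + t • e) (EuclideanSpace.single i 1) i) * g x)
      (∫ x, ∑ i, fderiv ℝ a x e i * fderiv ℝ g x (EuclideanSpace.single i 1)) 0 := by
  have hda := ha.continuous_fderiv one_ne_zero
  have hdg := hg.continuous_fderiv one_ne_zero
  have hdgi : ∀ i : Fin N, Continuous fun x => fderiv ℝ g x (EuclideanSpace.single i 1) :=
    fun i => hdg.clm_apply continuous_const
  have hdgs : ∀ i : Fin N, HasCompactSupport fun x => fderiv ℝ g x (EuclideanSpace.single i 1) :=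
    fun i => (hgc.fderiv_apply (𝕜 := ℝ) _)
  have hai : ∀ i : Fin N, ContDiff ℝ 1 fun x => a x i := fun i => by fun_prop
  have hfai : ∀ (i : Fin N) (x w : Euc N), fderiv ℝ (fun x => a x i) x w = fderiv ℝ a x w i := by
    intro i x w
    have := ((EuclideanSpace.proj (𝕜 := ℝ) i).hasFDerivAt.comp x
      (ha.differentiable one_ne_zero x).hasFDerivAt).fderiv
    exact congrArg (fun L => L w) this
  have hline : ∀ (x : Euc N) (t : ℝ), HasDerivAt (fun t : ℝ => x + t • e) e t := fun x t => by
    simpa using ((hasDerivAt_id t).smul_const e).const_add x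
  have hibp : ∀ t : ℝ,
      ∫ x, (-∑ i, fderiv ℝ a (x + t • e) (EuclideanSpace.single i 1) i) * g x =
        ∫ x, ∑ i, a (x + t • e) i * fderiv ℝ g x (EuclideanSpace.single i 1) := by
    intro t
    have hshift : ∀ i : Fin N, ContDiff ℝ 1 fun x => a (x + t • e) i := fun i => by fun_prop
    have hfs : ∀ (i : Fin N) (x w : Euc N),
        fderiv ℝ (fun x => a (x + t • e) i) x w = fderiv ℝ a (x + t • e) w i := by
      intro i x w
      rw [fderiv_comp_add_right (f := fun x => a x i), hfai]
    have hc1 : ∀ i : Fin N, Continuous fun x =>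
        fderiv ℝ a (x + t • e) (EuclideanSpace.single i 1) i * g x := by
      intro i
      have := hg.continuous
      fun_prop
    have hc2 : ∀ i : Fin N, Continuous fun x =>
        a (x + t • e) i * fderiv ℝ g x (EuclideanSpace.single i 1) :=
      fun i => (hshift i).continuous.mul (hdgi i)
    have hi1 : ∀ i : Fin N, Integrable fun x =>
        fderiv ℝ a (x + t • e) (EuclideanSpace.single i 1) i * g x :=
      fun i => (hc1 i).integrable_of_hasCompactSupport hgc.mul_left
    have hi2 : ∀ i : Fin N, Integrable fun x =>
        a (x + t • e) i * fderiv ℝ g x (EuclideanSpace.single i 1) :=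
      fun i => (hc2 i).integrable_of_hasCompactSupport (hdgs i).mul_left
    simp only [neg_mul, Finset.sum_mul]
    rw [integral_neg, integral_finsetSum _ fun i _ => hi1 i, integral_finsetSum _ fun i _ => hi2 i,
      ← Finset.sum_neg_distrib]
    refine Finset.sum_congr rfl fun i _ => ?_
    have := integral_mul_fderiv_eq_neg_fderiv_mul_of_integrable (μ := volume)
      (f := fun x => a (x + t • e) i) (g := g) (v := EuclideanSpace.single i 1)
      (by simpa only [hfs] using hi1 i) (hi2 i)
      (((hshift i).continuous.mul hg.continuous).integrable_of_hasCompactSupport hgc.mul_left)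
      (fun x _ => (hshift i).differentiable one_ne_zero x) (fun x _ => hg.differentiable one_ne_zero x)
    simp only [hfs] at this
    exact this.symm
  simp only [hibp]
  obtain ⟨M, hM⟩ := (hac.fderiv (𝕜 := ℝ)).exists_bound_of_continuous hda
  have hmain := hasDerivAt_integral_of_dominated_loc_of_deriv_le (μ := (volume : Measure (Euc N)))
    (F := fun (t : ℝ) x => ∑ i, a (x + t • e) i * fderiv ℝ g x (EuclideanSpace.single i 1))
    (F' := fun (t : ℝ) x => ∑ i, fderiv ℝ a (x + t • e) e i *
      fderiv ℝ g x (EuclideanSpace.single i 1))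
    (x₀ := (0 : ℝ)) (s := Set.univ)
    (bound := fun x => ∑ i, M * ‖e‖ * ‖fderiv ℝ g x (EuclideanSpace.single i 1)‖)
    Filter.univ_mem ?_ ?_ ?_ ?_ ?_ ?_
  · simpa using hmain.2
  · refine Filter.Eventually.of_forall fun t => Continuous.aestronglyMeasurable ?_
    fun_prop
  · refine integrable_finsetSum _ fun i _ => ?_
    refine Continuous.integrable_of_hasCompactSupport (by fun_prop) ((hdgs i).mul_left)
  · refine Continuous.aestronglyMeasurable ?_
    fun_prop
  · refine Filter.Eventually.of_forall fun x t _ => ?_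
    refine (norm_sum_le _ _).trans (Finset.sum_le_sum fun i _ => ?_)
    rw [norm_mul]
    gcongr
    exact (PiLp.norm_apply_le _ i).trans (((fderiv ℝ a _).le_opNorm e).trans
      (mul_le_mul_of_nonneg_right (hM _) (norm_nonneg _)))
  · refine integrable_finsetSum _ fun i _ => ?_
    exact ((hdgi i).integrable_of_hasCompactSupport (hdgs i)).norm.const_mul _
  · refine Filter.Eventually.of_forall fun x t _ => ?_
    refine HasDerivAt.fun_sum fun i _ => HasDerivAt.mul_const ?_ _
    have h1 := (((hai i).differentiable one_ne_zero (x + t • e)).hasFDerivAt).comp_hasDerivAt t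
      (hline x t)
    rw [hfai] at h1
    exact h1

/-- A derivative in a direction `e` of a function in a fractional space `W^{s,q}`, tested against
`g`: the estimate only uses a weighted bound on the derivative of `g` in the same direction. -/
theorem exists_abs_deriv_integral_shift_mul_le (N : ℕ) (hN : 1 ≤ N) {s q m : ℝ} (hs : 0 < s)
    (hm : 0 < m) (hqp : q.HolderConjugate (2 * (m + 1))) (hσ : 1 < s + 1 / (m + 1)) :
    ∃ Cf C₁ C₂ : ℝ, 0 < Cf ∧ 0 < C₁ ∧ 0 < C₂ ∧
      ∀ (f g : Euc N → ℝ), Continuous f → ContDiff ℝ 1 g → HasCompactSupport g →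
      ∀ (x₀ : Euc N) (ρ h₀ : ℝ), 0 < h₀ → (∀ x, x ∉ ball x₀ ρ → g x = 0) →
      gagliardoQ s q (ball x₀ (ρ + h₀)) f ≠ ⊤ →
      ∀ (e : Euc N), ‖e‖ = 1 → ∀ F' A P : ℝ, 0 ≤ A → 0 ≤ P →
        ∫⁻ x, ‖g x‖ₑ ^ (2 * (m + 1)) ≤ ENNReal.ofReal A →
        ∫⁻ x, ‖|g x| ^ m * fderiv ℝ g x e‖ₑ ^ 2 ≤ ENNReal.ofReal P →
        HasDerivAt (fun t : ℝ => ∫ x, f (x + t • e) * g x) F' 0 →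
        |F'| ≤ (Cf * (gagliardoQ s q (ball x₀ (ρ + h₀)) f).toReal) ^ (1 / q) *
          (h₀ ^ (s - 1) * A ^ (1 / (2 * (m + 1))) +
            C₂ * h₀ ^ (s + 1 / (m + 1) - 1) * (C₁ * P) ^ (1 / (2 * (m + 1)))) := by
  have hq1 : 1 ≤ q := hqp.lt.le
  have hq0 : 0 < q := hqp.pos
  obtain ⟨Cf, hCf, hNik⟩ := exists_lintegral_diff_le_gagliardoQ N hN hs hq1
  set p : ℝ := 2 * (m + 1) with hp
  have hp0 : 0 < p := by positivity
  set σ : ℝ := s + 1 / (m + 1) - 1 with hσdef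
  have hσ0 : 0 < σ := by linarith
  set C₁ : ℝ := (2 ^ (m + 1) * (m + 1)) ^ 2 with hC₁
  have hC₂ : 0 < (1 - (2 : ℝ) ^ (-σ))⁻¹ :=
    inv_pos.2 (sub_pos.2 (Real.rpow_lt_one_of_one_lt_of_neg (by norm_num) (by linarith)))
  refine ⟨Cf, C₁, (1 - 2 ^ (-σ))⁻¹, hCf, by positivity, hC₂, ?_⟩
  intro f g hf hg hgc x₀ ρ h₀ hh₀ hsupp hfin e he F' A P hA hP hgA hgP hF
  set Φ : ℝ := (gagliardoQ s q (ball x₀ (ρ + h₀)) f).toReal with hΦ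
  have hΦ0 : 0 ≤ Φ := ENNReal.toReal_nonneg
  have hgcont := hg.continuous
  have hdiff : ∀ h : ℝ, 0 < h → ∀ (T : ℝ), T ≤ ρ + h₀ - h →
      (∫⁻ x in ball x₀ T, ‖f (x + h • e) - f x‖ₑ ^ q) ^ (1 / q) ≤
        ENNReal.ofReal ((Cf * Φ) ^ (1 / q) * h ^ s) := by
    intro h hh T hT
    have hne : h • e ≠ 0 := by
      rw [← norm_pos_iff, norm_smul, he, mul_one]; exact norm_pos_iff.2 hh.ne'
    have hnorm : ‖h • e‖ = h := by rw [norm_smul, he, mul_one, Real.norm_of_nonneg hh.le]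
    have h1 := hNik f hf x₀ (ρ + h₀) (h • e) hne
    rw [hnorm, ← ENNReal.ofReal_toReal hfin, ← ENNReal.ofReal_mul (by positivity)] at h1
    have h2 := (lintegral_mono_set (ball_subset_ball hT)).trans h1
    refine (ENNReal.rpow_le_rpow h2 (by positivity)).trans (le_of_eq ?_)
    rw [ENNReal.ofReal_rpow_of_nonneg (by positivity) (by positivity)]
    congr 1
    rw [show Cf * h ^ (s * q) * Φ = Cf * Φ * h ^ (s * q) by ring,
      Real.mul_rpow (by positivity) (by positivity), ← Real.rpow_mul hh.le]
    congr 2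
    field_simp
  have hint : ∀ t : ℝ, Integrable fun x => f (x + t • e) * g x := fun t =>
    Continuous.integrable_of_hasCompactSupport (by fun_prop) hgc.mul_left
  have hfirst : |(∫ x, f (x + h₀ • e) * g x) - ∫ x, f (x + (0 : ℝ) • e) * g x| ≤
      (Cf * Φ) ^ (1 / q) * h₀ ^ s * A ^ (1 / p) := by
    rw [← integral_sub (hint h₀) (hint 0)]
    simp only [zero_smul, add_zero, ← sub_mul]
    have h1 := enorm_integral_mul_le (volume : Measure (Euc N)) hqp
      (φ := fun x => f (x + h₀ • e) - f x) (ψ := g) (by fun_prop) (by fun_prop) hsupp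
    have h2 := h1.trans (mul_le_mul' (hdiff h₀ hh₀ ρ (by linarith))
      (ENNReal.rpow_le_rpow hgA (by positivity)))
    rw [ENNReal.ofReal_rpow_of_nonneg hA (by positivity), ← ENNReal.ofReal_mul (by positivity),
      Real.enorm_eq_ofReal_abs] at h2
    exact (ENNReal.ofReal_le_ofReal_iff (by positivity)).1 h2
  have hsecond : ∀ h, 0 < h → 2 * h ≤ h₀ →
      |(∫ x, f (x + (2 * h) • e) * g x) - 2 * (∫ x, f (x + h • e) * g x) +
        ∫ x, f (x + (0 : ℝ) • e) * g x| ≤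
      ((Cf * Φ) ^ (1 / q) * (C₁ * P) ^ (1 / p)) * h ^ (1 + σ) := by
    intro h hh hh2
    have hid : (∫ x, f (x + (2 * h) • e) * g x) - 2 * (∫ x, f (x + h • e) * g x) +
        ∫ x, f (x + (0 : ℝ) • e) * g x =
        ∫ x, (f (x + h • e) - f x) * (g (x - h • e) - g x) := by
      have hgs : HasCompactSupport fun x => g (x - h • e) := by
        simpa [sub_eq_add_neg, Function.comp_def] using
          hgc.comp_homeomorph (Homeomorph.addRight (-(h • e)))
      have e1 : ∫ x, f (x + h • e) * g (x - h • e) = ∫ x, f (x + (2 * h) • e) * g x := by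
        rw [← integral_add_right_eq_self _ (h • e)]
        simp only [add_sub_cancel_right, add_assoc, ← add_smul, two_mul]
      have e2 : ∫ x, f x * g (x - h • e) = ∫ x, f (x + h • e) * g x := by
        rw [← integral_add_right_eq_self _ (h • e)]
        simp only [add_sub_cancel_right]
      have i1 : Integrable fun x => f (x + h • e) * g (x - h • e) :=
        Continuous.integrable_of_hasCompactSupport (by fun_prop) hgs.mul_left
      have i2 : Integrable fun x => f x * g (x - h • e) :=
        Continuous.integrable_of_hasCompactSupport (by fun_prop) hgs.mul_left
      have i3 := hint h
      have i4 := hint 0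
      simp only [zero_smul, add_zero] at i4 ⊢
      calc _ = (∫ x, f (x + h • e) * g (x - h • e)) - (∫ x, f x * g (x - h • e)) -
              ((∫ x, f (x + h • e) * g x) - ∫ x, f x * g x) := by rw [e1, e2]; ring
        _ = ∫ x, (f (x + h • e) * g (x - h • e) - f x * g (x - h • e)) -
              (f (x + h • e) * g x - f x * g x) := by
            rw [← integral_sub i1 i2, ← integral_sub i3 i4]
            exact (integral_sub (i1.sub i2) (i3.sub i4)).symm
        _ = _ := by
            congr 1
            ext x
            ring
    rw [hid]
    have hsupp2 : ∀ x, x ∉ ball x₀ (ρ + h) → g (x - h • e) - g x = 0 := by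
      intro x hx
      rw [mem_ball_iff_norm, not_lt] at hx
      have hnorm : ‖h • e‖ = h := by rw [norm_smul, he, mul_one, Real.norm_of_nonneg hh.le]
      rw [hsupp x, hsupp (x - h • e), sub_zero]
      · rw [mem_ball_iff_norm, not_lt]
        have := norm_sub_norm_le (x - x₀) (h • e)
        rw [sub_right_comm] at this
        linarith
      · rw [mem_ball_iff_norm, not_lt]
        linarith
    have hgdiff : ∫⁻ x, ‖g (x - h • e) - g x‖ₑ ^ p ≤ ENNReal.ofReal (C₁ * P * h ^ 2) := by
      rw [← lintegral_add_right_eq_self _ (h • e)]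
      simp only [add_sub_cancel_right]
      have h1 := lintegral_diff_rpow_le (volume : Measure (Euc N)) hm hg e hh.le
      have h2 : ∀ x, ‖g x - g (x + h • e)‖ₑ = ‖g (x + h • e) - g x‖ₑ := fun x => by
        rw [← edist_eq_enorm_sub, edist_comm, edist_eq_enorm_sub]
      simp only [h2]
      refine h1.trans ((mul_le_mul_right hgP _).trans (le_of_eq ?_))
      rw [← ENNReal.ofReal_mul (by positivity)]
      congr 1
      ring
    have h1 := enorm_integral_mul_le (volume : Measure (Euc N)) hqp
      (φ := fun x => f (x + h • e) - f x) (ψ := fun x => g (x - h • e) - g x)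
      (by fun_prop) (by fun_prop) hsupp2
    have h2 := h1.trans (mul_le_mul' (hdiff h hh (ρ + h) (by linarith))
      (ENNReal.rpow_le_rpow hgdiff (by positivity)))
    rw [ENNReal.ofReal_rpow_of_nonneg (by positivity) (by positivity),
      ← ENNReal.ofReal_mul (by positivity), Real.enorm_eq_ofReal_abs] at h2
    refine ((ENNReal.ofReal_le_ofReal_iff (by positivity)).1 h2).trans (le_of_eq ?_)
    rw [Real.mul_rpow (x := C₁ * P) (by positivity) (by positivity), ← Real.rpow_natCast h 2,
      ← Real.rpow_mul hh.le]
    have h3 : h ^ (1 + σ) = h ^ s * h ^ (((2 : ℕ) : ℝ) * (1 / p)) := by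
      rw [← Real.rpow_add hh]
      congr 1
      rw [hσdef, hp]
      push_cast
      field_simp
      ring
    rw [h3]
    ring
  have hfin' := abs_deriv_le_of_second_difference_le hσ0 hh₀ (by positivity) hF hsecond
  refine hfin'.trans ?_
  have h4 : |(∫ x, f (x + h₀ • e) * g x) - ∫ x, f (x + (0 : ℝ) • e) * g x| / h₀ ≤
      (Cf * Φ) ^ (1 / q) * (h₀ ^ (s - 1) * A ^ (1 / p)) := by
    rw [div_le_iff₀ hh₀]
    refine hfirst.trans (le_of_eq ?_)
    rw [Real.rpow_sub_one hh₀.ne']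
    field_simp
  rw [mul_add]
  refine add_le_add h4 (le_of_eq ?_)
  ring

section CutoffTestFunction

variable {N : ℕ} {v : Euc N → Euc N} {ζ : Euc N → ℝ} {x : Euc N} {m ε κ : ℝ}

theorem fderiv_sq_mul_coord_apply (hv : DifferentiableAt ℝ v x) (hζ : DifferentiableAt ℝ ζ x)
    (j : Fin N) (w : Euc N) :
    fderiv ℝ (fun y => ζ y ^ 2 * v y j) x w =
      ζ x ^ 2 * fderiv ℝ v x w j + 2 * ζ x * fderiv ℝ ζ x w * v x j := by
  have h1 : HasFDerivAt (fun y => v y j) ((EuclideanSpace.proj (𝕜 := ℝ) j).comp (fderiv ℝ v x)) x :=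
    (EuclideanSpace.proj (𝕜 := ℝ) j).hasFDerivAt.comp x hv.hasFDerivAt
  have h2 : HasFDerivAt (fun y => ζ y ^ 2 * v y j) _ x := (hζ.hasFDerivAt.pow 2).mul h1
  rw [h2.fderiv]
  simp
  ring

theorem energy_le_sum_fderiv_mul_fderiv (hm : 0 < m) (hε : 0 < ε) (hv : DifferentiableAt ℝ v x)
    (hsymm : ∀ i j, fderiv ℝ v x (EuclideanSpace.single i 1) j =
      fderiv ℝ v x (EuclideanSpace.single j 1) i)
    (hζ : DifferentiableAt ℝ ζ x) (hζ0 : 0 ≤ ζ x) (hκ : ‖fderiv ℝ ζ x‖ ≤ κ) (j : Fin N) :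
    ζ x ^ 2 * ((ε + ‖v x‖ ^ 2) ^ m * ‖fderiv ℝ v x (EuclideanSpace.single j 1)‖ ^ 2) / 2 -
        2 * (1 + 2 * m) ^ 2 * κ ^ 2 * (ε + ‖v x‖ ^ 2) ^ (m + 1) ≤
      ∑ i, fderiv ℝ (fun y => (ε + ‖v y‖ ^ 2) ^ m • v y) x (EuclideanSpace.single j 1) i *
        fderiv ℝ (fun y => ζ y ^ 2 * v y j) x (EuclideanSpace.single i 1) := by
  have hpos : 0 < ε + ‖v x‖ ^ 2 := by positivity
  set b := fderiv ℝ (fun y => (ε + ‖v y‖ ^ 2) ^ m • v y) x (EuclideanSpace.single j 1) with hb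
  set ξ := fderiv ℝ v x (EuclideanSpace.single j 1) with hξ
  set W := ε + ‖v x‖ ^ 2 with hW
  have hκ0 : 0 ≤ κ := (norm_nonneg _).trans hκ
  have h1 : W ^ m * ‖ξ‖ ^ 2 ≤ inner ℝ b ξ :=
    le_inner_fderiv_rpow_smul_apply hm.le hv hpos _
  have h2 : ‖b‖ ≤ (1 + 2 * m) * W ^ m * ‖ξ‖ :=
    norm_fderiv_rpow_smul_apply_le hm.le hε.le hv hpos _
  have hsum : ∑ i, b i * fderiv ℝ (fun y => ζ y ^ 2 * v y j) x (EuclideanSpace.single i 1) =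
      ζ x ^ 2 * inner ℝ b ξ + 2 * ζ x * v x j * fderiv ℝ ζ x b := by
    have hb' : fderiv ℝ ζ x b = ∑ i, b i * fderiv ℝ ζ x (EuclideanSpace.single i 1) := by
      conv_lhs => rw [← (EuclideanSpace.basisFun (Fin N) ℝ).sum_repr b]
      simp
    rw [hb', PiLp.inner_apply, Finset.mul_sum, Finset.mul_sum, ← Finset.sum_add_distrib]
    refine Finset.sum_congr rfl fun i _ => ?_
    rw [fderiv_sq_mul_coord_apply hv hζ, hsymm i j]
    simp only [RCLike.inner_apply, conj_trivial, hξ]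
    ring
  have h3 : |2 * ζ x * v x j * fderiv ℝ ζ x b| ≤
      2 * ζ x * ‖v x‖ * (κ * ((1 + 2 * m) * W ^ m * ‖ξ‖)) := by
    have h4 : |v x j| ≤ ‖v x‖ := PiLp.norm_apply_le (v x) j
    have h5 : |fderiv ℝ ζ x b| ≤ κ * ((1 + 2 * m) * W ^ m * ‖ξ‖) :=
      ((fderiv ℝ ζ x).le_opNorm b).trans (mul_le_mul hκ h2 (norm_nonneg _) hκ0)
    rw [abs_mul, abs_mul, abs_of_nonneg (by positivity : 0 ≤ 2 * ζ x)]
    gcongr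
  have h6 : W ^ m * ‖v x‖ ^ 2 ≤ W ^ (m + 1) := by
    rw [Real.rpow_add_one hpos.ne']
    exact mul_le_mul_of_nonneg_left (by linarith) (by positivity)
  have h7 : 2 * (ζ x * ‖ξ‖) * ((1 + 2 * m) * κ * ‖v x‖) ≤
      (ζ x * ‖ξ‖) ^ 2 / 2 + 2 * ((1 + 2 * m) * κ * ‖v x‖) ^ 2 := by
    nlinarith [sq_nonneg (ζ x * ‖ξ‖ - 2 * ((1 + 2 * m) * κ * ‖v x‖))]
  have h8 := mul_le_mul_of_nonneg_left h7 (by positivity : 0 ≤ W ^ m)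
  have h9 := mul_le_mul_of_nonneg_left h6 (by positivity : 0 ≤ 2 * (1 + 2 * m) ^ 2 * κ ^ 2)
  have h10 := mul_le_mul_of_nonneg_left h1 (by positivity : 0 ≤ ζ x ^ 2)
  have h11 := neg_le_of_abs_le h3
  rw [hsum]
  linarith

theorem abs_sq_mul_coord_le (hζ0 : 0 ≤ ζ x) (hζ1 : ζ x ≤ 1) (j : Fin N) :
    |ζ x ^ 2 * v x j| ≤ ‖v x‖ := by
  have h4 : |v x j| ≤ ‖v x‖ := PiLp.norm_apply_le (v x) j
  rw [abs_mul, abs_of_nonneg (by positivity : 0 ≤ ζ x ^ 2)]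
  exact (mul_le_of_le_one_left (abs_nonneg _) (pow_le_one₀ hζ0 hζ1)).trans h4

theorem abs_sq_mul_coord_rpow_le (hm : 0 < m) (hε : 0 < ε) (hζ0 : 0 ≤ ζ x) (hζ1 : ζ x ≤ 1)
    (j : Fin N) : |ζ x ^ 2 * v x j| ^ (2 * (m + 1)) ≤ (ε + ‖v x‖ ^ 2) ^ (m + 1) := by
  rw [Real.rpow_mul (abs_nonneg _), Real.rpow_two]
  refine Real.rpow_le_rpow (by positivity) ?_ (by positivity)
  have := pow_le_pow_left₀ (abs_nonneg _) (abs_sq_mul_coord_le (v := v) hζ0 hζ1 j) 2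
  linarith

theorem sq_rpow_mul_fderiv_le (hm : 0 < m) (hε : 0 < ε) (hv : DifferentiableAt ℝ v x)
    (hζ : DifferentiableAt ℝ ζ x) (hζ0 : 0 ≤ ζ x) (hζ1 : ζ x ≤ 1) (hκ : ‖fderiv ℝ ζ x‖ ≤ κ)
    (j : Fin N) :
    (|ζ x ^ 2 * v x j| ^ m *
        fderiv ℝ (fun y => ζ y ^ 2 * v y j) x (EuclideanSpace.single j 1)) ^ 2 ≤
      2 * (ζ x ^ 2 * ((ε + ‖v x‖ ^ 2) ^ m * ‖fderiv ℝ v x (EuclideanSpace.single j 1)‖ ^ 2)) +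
        8 * κ ^ 2 * (ε + ‖v x‖ ^ 2) ^ (m + 1) := by
  have hpos : 0 < ε + ‖v x‖ ^ 2 := by positivity
  have hκ0 : 0 ≤ κ := (norm_nonneg _).trans hκ
  rw [fderiv_sq_mul_coord_apply hv hζ]
  set ξ := fderiv ℝ v x (EuclideanSpace.single j 1) with hξ
  set W := ε + ‖v x‖ ^ 2 with hW
  set z := fderiv ℝ ζ x (EuclideanSpace.single j 1) with hz
  have h1 : (|ζ x ^ 2 * v x j| ^ m) ^ 2 ≤ W ^ m := by
    rw [← Real.rpow_two, ← Real.rpow_mul (abs_nonneg _), mul_comm m,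
      Real.rpow_mul (abs_nonneg _), Real.rpow_two]
    refine Real.rpow_le_rpow (by positivity) ?_ hm.le
    have := pow_le_pow_left₀ (abs_nonneg _) (abs_sq_mul_coord_le (v := v) hζ0 hζ1 j) 2
    linarith
  have hz1 : |z| ≤ κ := by
    have := (fderiv ℝ ζ x).le_opNorm (EuclideanSpace.single j 1)
    rw [PiLp.norm_single, norm_one, mul_one] at this
    exact this.trans hκ
  have hz2 : z ^ 2 ≤ κ ^ 2 := sq_le_sq' (neg_le_of_abs_le hz1) (le_of_abs_le hz1)
  have hv2 : (v x j) ^ 2 ≤ ‖v x‖ ^ 2 := by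
    rw [← sq_abs]; exact pow_le_pow_left₀ (abs_nonneg _) (PiLp.norm_apply_le (v x) j) 2
  have hξ2 : (ξ j) ^ 2 ≤ ‖ξ‖ ^ 2 := by
    rw [← sq_abs]; exact pow_le_pow_left₀ (abs_nonneg _) (PiLp.norm_apply_le ξ j) 2
  have hζ2 : ζ x ^ 2 ≤ 1 := pow_le_one₀ hζ0 hζ1
  have h3 : (ζ x ^ 2 * ξ j + 2 * ζ x * z * v x j) ^ 2 ≤
      2 * (ζ x ^ 2 * ‖ξ‖ ^ 2) + 8 * (κ ^ 2 * ‖v x‖ ^ 2) := by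
    have e1 : ζ x ^ 2 * (ζ x ^ 2 * (ξ j) ^ 2) ≤ ζ x ^ 2 * ‖ξ‖ ^ 2 :=
      mul_le_mul_of_nonneg_left ((mul_le_of_le_one_left (sq_nonneg _) hζ2).trans hξ2) (sq_nonneg _)
    have e2 : ζ x ^ 2 * (z ^ 2 * (v x j) ^ 2) ≤ κ ^ 2 * ‖v x‖ ^ 2 :=
      (mul_le_of_le_one_left (by positivity) hζ2).trans (mul_le_mul hz2 hv2 (sq_nonneg _) (sq_nonneg _))
    nlinarith [sq_nonneg (ζ x ^ 2 * ξ j - 2 * ζ x * z * v x j)]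
  have h6 : W ^ m * ‖v x‖ ^ 2 ≤ W ^ (m + 1) := by
    rw [Real.rpow_add_one hpos.ne']
    exact mul_le_mul_of_nonneg_left (by linarith) (by positivity)
  rw [mul_pow]
  refine (mul_le_mul h1 h3 (sq_nonneg _) (by positivity)).trans ?_
  have h9 := mul_le_mul_of_nonneg_left h6 (by positivity : 0 ≤ 8 * κ ^ 2)
  linarith

end CutoffTestFunction

theorem rpow_mul_rpow_le_add {p q Y T : ℝ} (hqp : q.HolderConjugate p) (hY : 0 ≤ Y) (hT : 0 ≤ T) :
    Y ^ (1 / q) * T ^ (1 / p) ≤ Y + T := by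
  have h := Real.young_inequality_of_nonneg (Real.rpow_nonneg hY (1 / q))
    (Real.rpow_nonneg hT (1 / p)) hqp
  rw [← Real.rpow_mul hY, ← Real.rpow_mul hT, one_div_mul_cancel hqp.pos.ne',
    one_div_mul_cancel hqp.symm.pos.ne', Real.rpow_one, Real.rpow_one] at h
  exact h.trans (add_le_add (div_le_self hY hqp.lt.le) (div_le_self hT hqp.symm.lt.le))

theorem shift_bound_le_add {p q σ s h₀ C₁ C₂ Y J P : ℝ} (hqp : q.HolderConjugate p)
    (hs : s - 1 = σ - 2 / p) (hh : 0 < h₀) (hC₁ : 0 < C₁) (hC₂ : 0 < C₂) (hY : 0 ≤ Y) (hJ : 0 ≤ J)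
    (hP : 0 ≤ P) :
    Y ^ (1 / q) * (h₀ ^ (s - 1) * J ^ (1 / p) + C₂ * h₀ ^ σ * (C₁ * P) ^ (1 / p)) ≤
      (1 + (8 * C₁ * C₂ ^ p) ^ (1 / p * q)) * (Y * h₀ ^ (σ * q)) + J / h₀ ^ 2 + P / 8 := by
  have hp := hqp.symm.pos
  have hq := hqp.pos
  have hX : (Y * h₀ ^ (σ * q)) ^ (1 / q) = Y ^ (1 / q) * h₀ ^ σ := by
    rw [Real.mul_rpow hY (by positivity), ← Real.rpow_mul hh.le]
    congr 2; field_simp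
  have hD : (((8 * C₁ * C₂ ^ p) ^ (1 / p * q)) * (Y * h₀ ^ (σ * q))) ^ (1 / q) * (P / 8) ^ (1 / p) =
      Y ^ (1 / q) * h₀ ^ σ * (C₂ * (C₁ * P) ^ (1 / p)) := by
    have e1 : C₂ * (C₁ * P) ^ (1 / p) = (8 * C₁ * C₂ ^ p) ^ (1 / p) * (P / 8) ^ (1 / p) := by
      rw [← Real.mul_rpow (by positivity) (by positivity),
        show 8 * C₁ * C₂ ^ p * (P / 8) = C₂ ^ p * (C₁ * P) by ring,
        Real.mul_rpow (x := C₂ ^ p) (by positivity) (by positivity), ← Real.rpow_mul hC₂.le,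
        mul_one_div_cancel hp.ne', Real.rpow_one]
    rw [e1, Real.mul_rpow (by positivity) (by positivity), hX, ← Real.rpow_mul (by positivity),
      mul_assoc (1 / p), mul_one_div_cancel hq.ne', mul_one]
    ring
  have h1 := rpow_mul_rpow_le_add hqp (by positivity : 0 ≤ Y * h₀ ^ (σ * q))
    (by positivity : 0 ≤ J / h₀ ^ 2)
  have h2 := rpow_mul_rpow_le_add hqp
    (by positivity : 0 ≤ (8 * C₁ * C₂ ^ p) ^ (1 / p * q) * (Y * h₀ ^ (σ * q)))
    (by positivity : 0 ≤ P / 8)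
  have hJ' : (J / h₀ ^ 2) ^ (1 / p) * h₀ ^ σ = h₀ ^ (s - 1) * J ^ (1 / p) := by
    rw [hs, Real.rpow_sub hh, Real.div_rpow hJ (by positivity), ← Real.rpow_two,
      ← Real.rpow_mul hh.le, mul_one_div]
    ring
  rw [hX] at h1
  rw [hD] at h2
  calc _ = Y ^ (1 / q) * h₀ ^ σ * (J / h₀ ^ 2) ^ (1 / p) +
        Y ^ (1 / q) * h₀ ^ σ * (C₂ * (C₁ * P) ^ (1 / p)) := by
        rw [mul_add, ← hJ']; ring
    _ ≤ _ := by linarith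

set_option maxHeartbeats 400000 in
theorem exists_setIntegral_energy_le (N : ℕ) (hN : 1 ≤ N) {m s q : ℝ} (hs : 0 < s) (hm : 0 < m)
    (hqp : q.HolderConjugate (2 * (m + 1))) (hσ : 1 < s + 1 / (m + 1)) :
    ∃ C : ℝ, 0 < C ∧ ∀ ε : ℝ, 0 < ε → ∀ v : Euc N → Euc N, ContDiff ℝ 1 v → HasCompactSupport v →
      ∀ (x₀ : Euc N) (r R : ℝ), 0 < r → r < R →
      (∀ x ∈ ball x₀ R, ∀ i j, fderiv ℝ v x (EuclideanSpace.single i 1) j =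
        fderiv ℝ v x (EuclideanSpace.single j 1) i) →
      gagliardoQ s q (ball x₀ R) (fun x => -∑ i, fderiv ℝ (fun y => (ε + ‖v y‖ ^ 2) ^ m • v y) x
        (EuclideanSpace.single i 1) i) ≠ ⊤ →
      ∀ j, ∫ x in ball x₀ r, (ε + ‖v x‖ ^ 2) ^ m * ‖fderiv ℝ v x (EuclideanSpace.single j 1)‖ ^ 2 ≤
        C / (R - r) ^ 2 * (∫ x in ball x₀ R, (ε + ‖v x‖ ^ 2) ^ (m + 1)) +
        C * (R ^ ((s + 1 / (m + 1) - 1) * q) * (gagliardoQ s q (ball x₀ R) (fun x => -∑ i,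
          fderiv ℝ (fun y => (ε + ‖v y‖ ^ 2) ^ m • v y) x (EuclideanSpace.single i 1) i)).toReal) := by
  obtain ⟨Cf, C₁, C₂, hCf, hC₁, hC₂, hmain⟩ :=
    exists_abs_deriv_integral_shift_mul_le N hN hs hm hqp hσ
  obtain ⟨K, hK, hcut⟩ := exists_contDiff_cutoff N
  set M := 1 + (8 * C₁ * C₂ ^ (2 * (m + 1))) ^ (1 / (2 * (m + 1)) * q) with hM
  have hM0 : 0 < M := by positivity
  set D := 4 * (4 + 4 * K ^ 2 + 8 * (1 + 2 * m) ^ 2 * K ^ 2) with hD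
  have hD0 : 0 < D := by positivity
  refine ⟨D + 4 * M * Cf, by positivity, fun ε hε v hv hvc x₀ r R hr hrR hsymm hΦ j => ?_⟩
  set a : Euc N → Euc N := fun y => (ε + ‖v y‖ ^ 2) ^ m • v y with ha
  set Φ := gagliardoQ s q (ball x₀ R) (fun x => -∑ i, fderiv ℝ a x (EuclideanSpace.single i 1) i)
    with hΦdef
  have hW : ∀ x, 0 < ε + ‖v x‖ ^ 2 := fun x => by positivity
  have hWc : ContDiff ℝ 1 fun x => ε + ‖v x‖ ^ 2 := contDiff_const.add (hv.norm_sq ℝ)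
  have haC : ContDiff ℝ 1 a := (hWc.rpow_const_of_ne fun x => (hW x).ne').smul hv
  have hac : HasCompactSupport a := by
    refine hvc.mono fun x hx => ?_
    contrapose! hx
    simp only [Function.mem_support, not_not] at hx ⊢
    simp [ha, hx]
  have hdv : ∀ x, DifferentiableAt ℝ v x := fun x => (hv.differentiable one_ne_zero) x
  have hvf : Continuous (fderiv ℝ v) := hv.continuous_fderiv one_ne_zero
  set ρ := (R + r) / 2 with hρ
  have hrρ : r < ρ := by rw [hρ]; linarith
  have hh : 0 < (R - r) / 2 := by linarith
  obtain ⟨ζ, hζC, hζ0, hζ1, hζr, hζρ, hζd⟩ := hcut x₀ r ρ hr hrρ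
  set κ := K / (ρ - r) with hκ
  have hκ' : κ = 2 * K / (R - r) := by
    rw [hκ, hρ, show (R + r) / 2 - r = (R - r) / 2 by ring]
    field_simp
  have hdζ : ∀ x, DifferentiableAt ℝ ζ x := fun x => (hζC.differentiable one_ne_zero) x
  set g : Euc N → ℝ := fun y => ζ y ^ 2 * v y j with hg
  have hvj : ContDiff ℝ 1 fun y => v y j := (EuclideanSpace.proj (𝕜 := ℝ) j).contDiff.comp hv
  have hgC : ContDiff ℝ 1 g := (hζC.pow 2).mul hvj
  have hgc : HasCompactSupport g := by
    refine hvc.mono fun x hx => ?_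
    contrapose! hx
    simp only [Function.mem_support, not_not] at hx ⊢
    simp [hg, hx]
  have hg0 : ∀ x, x ∉ ball x₀ ρ → g x = 0 := fun x hx => by simp [hg, hζρ x hx]
  have hρR : ball x₀ ρ ⊆ ball x₀ R := ball_subset_ball (by rw [hρ]; linarith)
  have hdg : ∀ x, x ∉ ball x₀ R → ∀ w, fderiv ℝ g x w = 0 := fun x hx w => by
    rw [hg, fderiv_sq_mul_coord_apply (hdv x) (hdζ x), hζρ x fun h => hx (hρR h)]
    simp
  set ξ : Euc N → Euc N := fun x => fderiv ℝ v x (EuclideanSpace.single j 1) with hξ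
  have hξc : Continuous ξ := hvf.clm_apply continuous_const
  have hWm : ∀ t : ℝ, Continuous fun x => (ε + ‖v x‖ ^ 2) ^ t := fun t =>
    hWc.continuous.rpow_const fun x => Or.inl (hW x).ne'
  have hint : ∀ φ : Euc N → ℝ, Continuous φ → IntegrableOn φ (ball x₀ R) := fun φ hφ =>
    (hφ.continuousOn.integrableOn_compact (isCompact_closedBall x₀ R)).mono_set
      ball_subset_closedBall
  have hEc : Continuous fun x => (ε + ‖v x‖ ^ 2) ^ m * ‖ξ x‖ ^ 2 := (hWm m).mul (hξc.norm.pow 2)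
  have hIc : Continuous fun x => ζ x ^ 2 * ((ε + ‖v x‖ ^ 2) ^ m * ‖ξ x‖ ^ 2) :=
    (hζC.continuous.pow 2).mul hEc
  set I := ∫ x in ball x₀ R, ζ x ^ 2 * ((ε + ‖v x‖ ^ 2) ^ m * ‖ξ x‖ ^ 2) with hI
  set J := ∫ x in ball x₀ R, (ε + ‖v x‖ ^ 2) ^ (m + 1) with hJ
  have hI0 : 0 ≤ I := integral_nonneg fun x => by have := hW x; positivity
  have hJ0 : 0 ≤ J := integral_nonneg fun x => by have := hW x; positivity
  set L := ∫ x, ∑ i, fderiv ℝ a x (EuclideanSpace.single j 1) i *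
    fderiv ℝ g x (EuclideanSpace.single i 1) with hL
  have hLc : Continuous fun x => ∑ i, fderiv ℝ a x (EuclideanSpace.single j 1) i *
      fderiv ℝ g x (EuclideanSpace.single i 1) := by
    refine continuous_finsetSum _ fun i _ => Continuous.mul ?_ ?_
    · exact (EuclideanSpace.proj (𝕜 := ℝ) i).continuous.comp
        ((haC.continuous_fderiv one_ne_zero).clm_apply continuous_const)
    · exact (hgC.continuous_fderiv one_ne_zero).clm_apply continuous_const
  have hlow : I / 2 - 2 * (1 + 2 * m) ^ 2 * κ ^ 2 * J ≤ L := by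
    have e1 : L = ∫ x in ball x₀ R, ∑ i, fderiv ℝ a x (EuclideanSpace.single j 1) i *
        fderiv ℝ g x (EuclideanSpace.single i 1) := by
      refine (setIntegral_eq_integral_of_forall_compl_eq_zero fun x hx => ?_).symm
      exact Finset.sum_eq_zero fun i _ => by rw [hdg x hx, mul_zero]
    rw [e1, hI, hJ, ← integral_div, ← integral_const_mul,
      ← integral_sub ((hint _ hIc).div_const _) ((hint _ (hWm _)).const_mul _)]
    refine setIntegral_mono_on (((hint _ hIc).div_const _).sub ((hint _ (hWm _)).const_mul _))
      (hint _ hLc) measurableSet_ball fun x hx => ?_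
    exact energy_le_sum_fderiv_mul_fderiv hm hε (hdv x) (hsymm x hx) (hdζ x) (hζ0 x) (hζd x) j
  have hA : ∫⁻ x, ‖g x‖ₑ ^ (2 * (m + 1)) ≤ ENNReal.ofReal J := by
    rw [hJ, ofReal_integral_eq_lintegral_ofReal (hint _ (hWm _))
      (ae_of_all _ fun x => by have := hW x; positivity), ← lintegral_indicator measurableSet_ball]
    refine lintegral_mono fun x => ?_
    by_cases hx : x ∈ ball x₀ R
    · rw [Set.indicator_of_mem hx, Real.enorm_eq_ofReal_abs,
        ENNReal.ofReal_rpow_of_nonneg (abs_nonneg _) (by positivity)]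
      exact ENNReal.ofReal_le_ofReal (abs_sq_mul_coord_rpow_le hm hε (hζ0 x) (hζ1 x) j)
    · rw [hg0 x fun h => hx (hρR h), enorm_zero, ENNReal.zero_rpow_of_pos (by positivity)]
      exact zero_le
  have hPc : Continuous fun x => 2 * (ζ x ^ 2 * ((ε + ‖v x‖ ^ 2) ^ m * ‖ξ x‖ ^ 2)) +
      8 * κ ^ 2 * (ε + ‖v x‖ ^ 2) ^ (m + 1) :=
    (hIc.const_mul 2).add ((hWm (m + 1)).const_mul (8 * κ ^ 2))
  have hP : ∫⁻ x, ‖|g x| ^ m * fderiv ℝ g x (EuclideanSpace.single j 1)‖ₑ ^ 2 ≤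
      ENNReal.ofReal (2 * I + 8 * κ ^ 2 * J) := by
    rw [hI, hJ, ← integral_const_mul, ← integral_const_mul,
      ← integral_add ((hint _ hIc).const_mul _) ((hint _ (hWm _)).const_mul _),
      ofReal_integral_eq_lintegral_ofReal
        (hint _ hPc)
        (ae_of_all _ fun x => by have := hW x; positivity), ← lintegral_indicator measurableSet_ball]
    refine lintegral_mono fun x => ?_
    by_cases hx : x ∈ ball x₀ R
    · rw [Set.indicator_of_mem hx, Real.enorm_eq_ofReal_abs, ← ENNReal.ofReal_pow (abs_nonneg _),
        sq_abs]
      exact ENNReal.ofReal_le_ofReal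
        (sq_rpow_mul_fderiv_le hm hε (hdv x) (hdζ x) (hζ0 x) (hζ1 x) (hζd x) j)
    · rw [hdg x hx, mul_zero, enorm_zero, zero_pow two_ne_zero]
      exact zero_le
  have hfc : Continuous fun x => -∑ i, fderiv ℝ a x (EuclideanSpace.single i 1) i :=
    (continuous_finsetSum _ fun i _ => (EuclideanSpace.proj (𝕜 := ℝ) i).continuous.comp
      ((haC.continuous_fderiv one_ne_zero).clm_apply continuous_const)).neg
  have hρh : ρ + (R - r) / 2 = R := by rw [hρ]; ring
  have hup := hmain (fun x => -∑ i, fderiv ℝ a x (EuclideanSpace.single i 1) i) g hfc hgC hgc x₀ ρ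
    ((R - r) / 2) hh hg0 (by rwa [hρh]) (EuclideanSpace.single j 1) (by simp) L J
    (2 * I + 8 * κ ^ 2 * J) hJ0 (by positivity) hA hP (hasDerivAt_integral_neg_div_mul haC hac hgC hgc _)
  rw [hρh, ← hΦdef] at hup
  have hup2 := (le_abs_self L).trans (hup.trans (shift_bound_le_add hqp (by field_simp; ring) hh hC₁ hC₂
    (by positivity) hJ0 (by positivity)))
  rw [← hM] at hup2
  have hIE : ∫ x in ball x₀ r, (ε + ‖v x‖ ^ 2) ^ m * ‖ξ x‖ ^ 2 ≤ I := by
    have hrR' : ball x₀ r ⊆ ball x₀ R := ball_subset_ball hrR.le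
    calc _ = ∫ x in ball x₀ r, ζ x ^ 2 * ((ε + ‖v x‖ ^ 2) ^ m * ‖ξ x‖ ^ 2) :=
          setIntegral_congr_fun measurableSet_ball fun x hx => by simp [hζr x hx]
      _ ≤ I := setIntegral_mono_set (hint _ hIc)
          (ae_of_all _ fun x => by have := hW x; positivity) hrR'.eventuallyLE
  have hY : ((R - r) / 2) ^ ((s + 1 / (m + 1) - 1) * q) ≤ R ^ ((s + 1 / (m + 1) - 1) * q) :=
    Real.rpow_le_rpow hh.le (by linarith) (mul_nonneg (by linarith) hqp.pos.le)
  refine hIE.trans ?_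
  have hY' := mul_le_mul_of_nonneg_left hY (by positivity : 0 ≤ M * (Cf * Φ.toReal))
  rw [hκ'] at hlow hup2
  have hJ1 : 0 ≤ 4 * M * Cf * (J / (R - r) ^ 2) := by positivity
  have hB1 : 0 ≤ D * (R ^ ((s + 1 / (m + 1) - 1) * q) * Φ.toReal) := by
    have : 0 < R := hr.trans hrR
    positivity
  have e1 : J / ((R - r) / 2) ^ 2 = 4 * (J / (R - r) ^ 2) := by field_simp; ring
  have e2 : (2 * K / (R - r)) ^ 2 * J = 4 * K ^ 2 * (J / (R - r) ^ 2) := by field_simp; ring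
  have e3 : (D + 4 * M * Cf) / (R - r) ^ 2 * J = (D + 4 * M * Cf) * (J / (R - r) ^ 2) := by
    field_simp
  rw [e1] at hup2
  rw [e3]
  rw [mul_assoc, e2] at hlow
  rw [mul_assoc 8 ((2 * K / (R - r)) ^ 2), e2] at hup2
  rw [hD] at hB1 ⊢
  linarith

open Topology in
theorem exists_contDiff_hasCompactSupport_eventuallyEq_gradient {N : ℕ} {u : Euc N → ℝ}
    {U : Set (Euc N)} (hU : IsOpen U) (hu : ContDiffOn ℝ 2 u U) {x₀ : Euc N} {R : ℝ} (hR : 0 < R)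
    (hsub : closedBall x₀ R ⊆ U) :
    ∃ v : Euc N → Euc N, ContDiff ℝ 1 v ∧ HasCompactSupport v ∧
      (∀ x ∈ ball x₀ R, v =ᶠ[𝓝 x] gradient u) ∧
      ∀ x i j, fderiv ℝ v x (EuclideanSpace.single i 1) j =
        fderiv ℝ v x (EuclideanSpace.single j 1) i := by
  obtain ⟨δ, hδ, hδU⟩ := (isCompact_closedBall x₀ R).exists_cthickening_subset_open hU hsub
  rw [cthickening_closedBall hδ.le hR.le] at hδU
  let χ : ContDiffBump x₀ := ⟨R, R + δ, hR, by linarith⟩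
  set w : Euc N → ℝ := fun x => χ x * u x with hw
  have hχ : tsupport χ ⊆ U := by
    rw [χ.tsupport_eq]
    simpa [χ, add_comm] using hδU
  have hwC : ContDiff ℝ 2 w := by
    refine contDiff_iff_contDiffAt.2 fun x => ?_
    by_cases hx : x ∈ tsupport χ
    · exact χ.contDiffAt.mul (hu.contDiffAt (hU.mem_nhds (hχ hx)))
    · refine (contDiffAt_const (c := (0 : ℝ))).congr_of_eventuallyEq ?_
      filter_upwards [notMem_tsupport_iff_eventuallyEq.1 hx] with y hy
      rw [hw]
      simp [hy]
  have hwc : HasCompactSupport w := χ.hasCompactSupport.mul_right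
  have hdw : ContDiff ℝ 1 (fderiv ℝ w) := hwC.fderiv_right (by norm_num)
  have hval : ∀ x (i : Fin N), gradient w x i = fderiv ℝ w x (EuclideanSpace.single i 1) := by
    intro x i
    have := InnerProductSpace.toDual_symm_apply (𝕜 := ℝ) (x := EuclideanSpace.single i (1 : ℝ))
      (y := fderiv ℝ w x)
    rw [← this, EuclideanSpace.inner_single_right, one_mul]
    rfl
  have hvC : ContDiff ℝ 1 (gradient w) :=
    (InnerProductSpace.toDual ℝ (Euc N)).symm.contDiff.comp hdw
  refine ⟨gradient w, hvC, ?_, fun x hx => ?_, fun x i j => ?_⟩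
  · exact (hwc.fderiv ℝ).comp_left (map_zero _)
  · filter_upwards [isOpen_ball.mem_nhds hx] with y hy
    have : w =ᶠ[𝓝 y] u := by
      filter_upwards [isOpen_ball.mem_nhds hy] with z hz
      rw [hw]
      simp only
      rw [χ.one_of_mem_closedBall (ball_subset_closedBall hz), one_mul]
    rw [gradient, gradient, this.fderiv_eq]
  · have hd : ∀ (k l : Fin N), fderiv ℝ (gradient w) x (EuclideanSpace.single k 1) l =
        fderiv ℝ (fderiv ℝ w) x (EuclideanSpace.single k 1) (EuclideanSpace.single l 1) := by
      intro k l
      have h1 : HasFDerivAt (fun y => gradient w y l) _ x :=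
        (EuclideanSpace.proj (𝕜 := ℝ) l).hasFDerivAt.comp x
          (hvC.differentiable one_ne_zero x).hasFDerivAt
      have h2 : HasFDerivAt (fun y => fderiv ℝ w y (EuclideanSpace.single l 1)) _ x :=
        (hdw.differentiable one_ne_zero x).hasFDerivAt.clm_apply (hasFDerivAt_const _ x)
      simp only [hval] at h1
      have h3 := congrArg (fun φ => φ (EuclideanSpace.single k (1 : ℝ))) (h1.unique h2)
      simpa using h3
    rw [hd, hd]
    exact (hwC.contDiffAt.isSymmSndFDerivAt (by simp)) _ _

/-- uniform Sobolev estimate for the regularized problem: if `u ∈ C²(B)`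
solves `-div((ε+|∇u|²)^{(p-2)/2} ∇u) = f` pointwise in the ball `B`, and
`𝒱_ε = |∇u|^{(p-2)/2} ∇u`, then for concentric balls `B_r ⋐ B_R ⋐ B`,
`∫_{B_r} |∂_j 𝒱_ε|² ≤ C (R-r)^{-2} ∫_{B_R} (ε+|∇u|²)^{p/2}
  + C (R^{s-(p-2)/p} [f]_{W^{s,p'}(B_R)})^{p'}`,
with `C = C(N,p,s)` independent of `ε`, `u`, `f`. -/
theorem statement10 (N : ℕ) (hN : 1 ≤ N) (p p' s : ℝ) (hp : 2 < p) (hp' : p' = p / (p - 1))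
    (hs0 : (p - 2) / p < s) (hs1 : s < 1) :
    ∃ C : ℝ, 0 < C ∧
      ∀ (ε : ℝ), 0 < ε → ∀ (c₀ : Euc N) (ρ : ℝ), 0 < ρ →
        ∀ (u f : Euc N → ℝ),
          ContDiffOn ℝ 2 u (ball c₀ ρ) →
          ContinuousOn f (ball c₀ ρ) →
          (∀ x ∈ ball c₀ ρ,
            -(∑ j : Fin N, fderiv ℝ
                (fun y : Euc N => ((ε + ‖gradient u y‖ ^ 2) ^ ((p - 2) / 2)) • gradient u y)
                x (EuclideanSpace.single j 1) j) = f x) →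
          ∀ (x₀ : Euc N) (r R : ℝ), 0 < r → r < R → closedBall x₀ R ⊆ ball c₀ ρ →
            (∫⁻ x in ball x₀ R, ENNReal.ofReal (‖gradient u x‖ ^ p)) < ⊤ →
            gagliardoQ s p' (ball x₀ R) f < ⊤ →
            ∀ j : Fin N,
              (∫⁻ x in ball x₀ r, ENNReal.ofReal
                  (‖fderiv ℝ (fun y : Euc N => (‖gradient u y‖ ^ ((p - 2) / 2)) • gradient u y)
                      x (EuclideanSpace.single j 1)‖ ^ 2)) ≤
                ENNReal.ofReal (C / (R - r) ^ 2) *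
                    (∫⁻ x in ball x₀ R, ENNReal.ofReal ((ε + ‖gradient u x‖ ^ 2) ^ (p / 2))) +
                  ENNReal.ofReal C *
                    (ENNReal.ofReal (R ^ (s - (p - 2) / p)) *
                      (gagliardoQ s p' (ball x₀ R) f) ^ (1 / p')) ^ p' := by
  have hp0 : 0 < p := by linarith
  set m := (p - 2) / 2 with hm_def
  have hm : 0 < m := by rw [hm_def]; linarith
  have hm1 : m + 1 = p / 2 := by rw [hm_def]; ring
  have hmp : 2 * (m + 1) = p := by rw [hm1]; ring
  have hσ : s + 1 / (m + 1) - 1 = s - (p - 2) / p := by rw [hm1]; field_simp; ring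
  have hs : 0 < s := lt_trans (div_pos (by linarith) hp0) hs0
  have hqp : p'.HolderConjugate (2 * (m + 1)) := by
    rw [hmp, hp']
    exact (Real.HolderConjugate.conjExponent (by linarith : 1 < p)).symm
  have hq0 : 0 < p' := hqp.pos
  obtain ⟨C, hC, hmain⟩ := exists_setIntegral_energy_le N hN hs hm hqp (by linarith)
  refine ⟨(1 + m) ^ 2 * C, by positivity, ?_⟩
  intro ε hε c₀ ρ _ u f hu _ hpde x₀ r R hr hrR hsub _ hΦ j
  have hR : 0 < R := hr.trans hrR
  obtain ⟨v, hv, hvc, hvu, hsymm⟩ :=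
    exists_contDiff_hasCompactSupport_eventuallyEq_gradient isOpen_ball hu hR hsub
  have hrR' : ball x₀ r ⊆ ball x₀ R := ball_subset_ball hrR.le
  have hW : ∀ x, 0 < ε + ‖v x‖ ^ 2 := fun x => by positivity
  have hWm : ∀ t : ℝ, Continuous fun x => (ε + ‖v x‖ ^ 2) ^ t := fun t =>
    (continuous_const.add (hv.continuous.norm.pow 2)).rpow_const fun x => Or.inl (hW x).ne'
  have hint : ∀ (φ : Euc N → ℝ) (t : ℝ), Continuous φ → IntegrableOn φ (ball x₀ t) := fun φ t hφ =>
    (hφ.continuousOn.integrableOn_compact (isCompact_closedBall x₀ t)).mono_set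
      ball_subset_closedBall
  have hEc : Continuous fun x =>
      (ε + ‖v x‖ ^ 2) ^ m * ‖fderiv ℝ v x (EuclideanSpace.single j 1)‖ ^ 2 :=
    (hWm m).mul (((hv.continuous_fderiv one_ne_zero).clm_apply continuous_const).norm.pow 2)
  have hf : ∀ x ∈ ball x₀ R, -∑ i, fderiv ℝ (fun y => (ε + ‖v y‖ ^ 2) ^ m • v y) x
      (EuclideanSpace.single i 1) i = f x := by
    intro x hx
    have h1 : (fun y => (ε + ‖v y‖ ^ 2) ^ m • v y) =ᶠ[nhds x]
        fun y => (ε + ‖gradient u y‖ ^ 2) ^ m • gradient u y := by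
      filter_upwards [hvu x hx] with y hy
      rw [hy]
    rw [h1.fderiv_eq]
    exact hpde x (hsub (ball_subset_closedBall hx))
  have hgag : gagliardoQ s p' (ball x₀ R) (fun x => -∑ i,
      fderiv ℝ (fun y => (ε + ‖v y‖ ^ 2) ^ m • v y) x (EuclideanSpace.single i 1) i) =
      gagliardoQ s p' (ball x₀ R) f := by
    refine setLIntegral_congr_fun measurableSet_ball fun x hx => ?_
    refine setLIntegral_congr_fun measurableSet_ball fun y hy => ?_
    simp only
    rw [hf x hx, hf y hy]
  have hcore := hmain ε hε v hv hvc x₀ r R hr hrR (fun x _ => hsymm x) (by rw [hgag]; exact hΦ.ne) j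
  rw [hgag, hσ] at hcore
  set J := ∫ x in ball x₀ R, (ε + ‖v x‖ ^ 2) ^ (m + 1) with hJ
  set Φ := gagliardoQ s p' (ball x₀ R) f with hΦ_def
  have hJ0 : 0 ≤ J := integral_nonneg fun x => by have := hW x; positivity
  have hJu : ∫⁻ x in ball x₀ R, ENNReal.ofReal ((ε + ‖gradient u x‖ ^ 2) ^ (p / 2)) =
      ENNReal.ofReal J := by
    rw [hJ, ofReal_integral_eq_lintegral_ofReal (hint _ _ (hWm _))
      (ae_of_all _ fun x => by have := hW x; positivity)]
    refine setLIntegral_congr_fun measurableSet_ball fun x hx => ?_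
    rw [(hvu x hx).eq_of_nhds, hm1]
  have hΦR : (ENNReal.ofReal (R ^ (s - (p - 2) / p)) * Φ ^ (1 / p')) ^ p' =
      ENNReal.ofReal (R ^ ((s - (p - 2) / p) * p') * Φ.toReal) := by
    rw [ENNReal.mul_rpow_of_nonneg _ _ hq0.le, ← ENNReal.rpow_mul, one_div_mul_cancel hq0.ne',
      ENNReal.rpow_one, ENNReal.ofReal_rpow_of_nonneg (by positivity) hq0.le, ← Real.rpow_mul hR.le,
      ENNReal.ofReal_mul (by positivity), ENNReal.ofReal_toReal hΦ.ne]
  have hleft : ∫⁻ x in ball x₀ r, ENNReal.ofReal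
      (‖fderiv ℝ (fun y : Euc N => (‖gradient u y‖ ^ m) • gradient u y)
        x (EuclideanSpace.single j 1)‖ ^ 2) ≤
      ENNReal.ofReal ((1 + m) ^ 2 * ∫ x in ball x₀ r,
        (ε + ‖v x‖ ^ 2) ^ m * ‖fderiv ℝ v x (EuclideanSpace.single j 1)‖ ^ 2) := by
    rw [← integral_const_mul, ofReal_integral_eq_lintegral_ofReal
      ((hint _ _ hEc).const_mul _) (ae_of_all _ fun x => by have := hW x; positivity)]
    refine setLIntegral_mono' measurableSet_ball fun x hx => ENNReal.ofReal_le_ofReal ?_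
    have h1 : (fun y => ‖gradient u y‖ ^ m • gradient u y) =ᶠ[nhds x]
        fun y => ‖v y‖ ^ m • v y := by
      filter_upwards [hvu x (hrR' hx)] with y hy
      rw [hy]
    rw [h1.fderiv_eq]
    have h2 := norm_fderiv_norm_rpow_smul_apply_le hm (hv.differentiable one_ne_zero x)
      (EuclideanSpace.single j 1)
    have h3 : (‖v x‖ ^ m) ^ 2 ≤ (ε + ‖v x‖ ^ 2) ^ m := by
      rw [← Real.rpow_two, ← Real.rpow_mul (norm_nonneg _), mul_comm m,
        Real.rpow_mul (norm_nonneg _), Real.rpow_two]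
      exact Real.rpow_le_rpow (by positivity) (by linarith) hm.le
    refine (pow_le_pow_left₀ (norm_nonneg _) h2 2).trans ?_
    rw [mul_pow, mul_pow, mul_assoc]
    gcongr
  rw [hJu, hΦR, ← ENNReal.ofReal_mul (by positivity), ← ENNReal.ofReal_mul (by positivity),
    ← ENNReal.ofReal_add (by positivity) (by positivity)]
  refine hleft.trans (ENNReal.ofReal_le_ofReal ?_)
  refine (mul_le_mul_of_nonneg_left hcore (by positivity)).trans_eq ?_
  ring
end

section
/- Let N ≥ 1, p > 2 and ε > 0, and define G_ε : ℝ^N → ℝ by G_ε(z) = (ε + |z|²)^{p/2}/p. Then G_ε is twice continuously differentiable and for all z, ξ ∈ ℝ^N one has |z|^{p−2} |ξ|² ≤ ⟨D²G_ε(z) ξ, ξ⟩ ≤ (p−1) (ε + |z|²)^{(p−2)/2} |ξ|², where D²G_ε(z) is the Hessian matrix of G_ε at z. -/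
open MeasureTheory ENNReal

section RegularizedPower

variable {E : Type*} [NormedAddCommGroup E] [InnerProductSpace ℝ E]

theorem hasFDerivAt_add_norm_sq_rpow {ε : ℝ} (hε : 0 < ε) (q : ℝ) (z : E) :
    HasFDerivAt (fun z : E => (ε + ‖z‖ ^ 2) ^ q)
      ((2 * q * (ε + ‖z‖ ^ 2) ^ (q - 1)) • innerSL ℝ z) z := by
  have hpos : 0 < ε + ‖z‖ ^ 2 := by positivity
  have h := ((hasStrictFDerivAt_norm_sq z).hasFDerivAt.const_add ε).rpow_const
    (p := q) (Or.inl hpos.ne')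
  convert h using 1
  ext v
  simp
  ring

theorem contDiff_add_norm_sq_rpow {ε : ℝ} (hε : 0 < ε) (q : ℝ) {n : WithTop ℕ∞} :
    ContDiff ℝ n (fun z : E => (ε + ‖z‖ ^ 2) ^ q) :=
  (contDiff_const.add (contDiff_norm_sq ℝ)).rpow_const_of_ne fun z => by positivity

theorem fderiv_add_norm_sq_rpow_div {p ε : ℝ} (hp : p ≠ 0) (hε : 0 < ε) :
    fderiv ℝ (fun z : E => (ε + ‖z‖ ^ 2) ^ (p / 2) / p) =
      fun z => (ε + ‖z‖ ^ 2) ^ (p / 2 - 1) • innerSL ℝ z := by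
  funext z
  have h := (hasFDerivAt_add_norm_sq_rpow hε (p / 2) z).mul_const p⁻¹
  simp only [← div_eq_mul_inv] at h
  rw [h.fderiv]
  ext v
  simp
  field_simp

theorem iteratedFDeriv_two_add_norm_sq_rpow_div {p ε : ℝ} (hp : p ≠ 0) (hε : 0 < ε)
    (z ξ : E) :
    iteratedFDeriv ℝ 2 (fun z : E => (ε + ‖z‖ ^ 2) ^ (p / 2) / p) z ![ξ, ξ] =
      (ε + ‖z‖ ^ 2) ^ (p / 2 - 1) * ‖ξ‖ ^ 2 +
        (p - 2) * (ε + ‖z‖ ^ 2) ^ (p / 2 - 1 - 1) * inner ℝ z ξ ^ 2 := by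
  rw [iteratedFDeriv_two_apply, fderiv_add_norm_sq_rpow_div hp hε]
  have h := (hasFDerivAt_add_norm_sq_rpow hε (p / 2 - 1) z).smul
    (innerSL ℝ (E := E)).hasFDerivAt
  refine (congrArg (fun L => L ξ ξ) h.fderiv).trans ?_
  change (ε + ‖z‖ ^ 2) ^ (p / 2 - 1) * inner ℝ ξ ξ +
    (2 * (p / 2 - 1) * (ε + ‖z‖ ^ 2) ^ (p / 2 - 1 - 1)) * inner ℝ z ξ * inner ℝ z ξ = _
  rw [real_inner_self_eq_norm_sq]
  ring

end RegularizedPower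

/-- for `N ≥ 1`, `p > 2`, `ε > 0`, the function
`G_ε(z) = (ε + |z|²)^{p/2} / p` is `C²` and its Hessian satisfies
`|z|^{p-2}|ξ|² ≤ ⟨D²G_ε(z) ξ, ξ⟩ ≤ (p-1)(ε+|z|²)^{(p-2)/2}|ξ|²` for all `z, ξ`. -/
theorem statement12 (N : ℕ) (hN : 1 ≤ N) (p ε : ℝ) (hp : 2 < p) (hε : 0 < ε) :
    ContDiff ℝ 2 (fun z : Euc N => (ε + ‖z‖ ^ 2) ^ (p / 2) / p) ∧
      ∀ z ξ : Euc N,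
        ‖z‖ ^ (p - 2) * ‖ξ‖ ^ 2 ≤
            iteratedFDeriv ℝ 2 (fun z : Euc N => (ε + ‖z‖ ^ 2) ^ (p / 2) / p) z ![ξ, ξ] ∧
          iteratedFDeriv ℝ 2 (fun z : Euc N => (ε + ‖z‖ ^ 2) ^ (p / 2) / p) z ![ξ, ξ] ≤
            (p - 1) * (ε + ‖z‖ ^ 2) ^ ((p - 2) / 2) * ‖ξ‖ ^ 2 := by
  have hp0 : p ≠ 0 := by linarith
  refine ⟨(contDiff_add_norm_sq_rpow hε _).div_const p, fun z ξ => ?_⟩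
  rw [iteratedFDeriv_two_add_norm_sq_rpow_div hp0 hε, show (p - 2) / 2 = p / 2 - 1 by ring]
  have hs : 0 < ε + ‖z‖ ^ 2 := by positivity
  have hp2 : 0 ≤ p - 2 := by linarith
  constructor
  · have hz : ‖z‖ ^ (p - 2) ≤ (ε + ‖z‖ ^ 2) ^ (p / 2 - 1) := by
      rw [show p - 2 = (2 : ℕ) * (p / 2 - 1) by push_cast; ring,
        Real.rpow_natCast_mul (norm_nonneg z)]
      exact Real.rpow_le_rpow (by positivity) (by linarith) (by linarith)
    have hrad : 0 ≤ (p - 2) * (ε + ‖z‖ ^ 2) ^ (p / 2 - 1 - 1) * inner ℝ z ξ ^ 2 := by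
      positivity
    linarith [mul_le_mul_of_nonneg_right hz (sq_nonneg ‖ξ‖)]
  · have hcs : inner ℝ z ξ ^ 2 ≤ (ε + ‖z‖ ^ 2) * ‖ξ‖ ^ 2 := by
      have h : inner ℝ z ξ ^ 2 ≤ (‖z‖ * ‖ξ‖) ^ 2 :=
        sq_le_sq.2 ((abs_real_inner_le_norm z ξ).trans (le_abs_self _))
      nlinarith [mul_nonneg hε.le (sq_nonneg ‖ξ‖)]
    have hpow : (ε + ‖z‖ ^ 2) ^ (p / 2 - 1) =
        (ε + ‖z‖ ^ 2) ^ (p / 2 - 1 - 1) * (ε + ‖z‖ ^ 2) := by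
      rw [← Real.rpow_add_one hs.ne', sub_add_cancel]
    have h := mul_le_mul_of_nonneg_left hcs
      (mul_nonneg hp2 (Real.rpow_nonneg hs.le (p / 2 - 1 - 1)))
    rw [hpow]
    linarith
end
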